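/- arXiv:0903.3189 — 4 statements merged into one kernel-verified Lean document; each statement's English description precedes it below -/
import Mathlib

section
/- There exist constants c₁, c₂ > 0 such that for all ξ, η ∈ ℝ² with η ≠ 0 and η − ξ ≠ 0, one has c₁ · |ξ| ρ₊ / (|η| |η−ξ|) ≤ ∠(η, η−ξ)² ≤ c₂ · |ξ| ρ₊ / (|η| |η−ξ|). -/
noncomputable section

/-- ℝ² with the Euclidean norm. -/
abbrev E2 : Type := EuclideanSpace ℝ (Fin 2)

/-- ρ₊ = |ξ| − ||η| − |η−ξ||. -/
def rhoPlus (ξ η : E2) : ℝ := ‖ξ‖ - |‖η‖ - ‖η - ξ‖|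

/-- By the law of cosines, `|ξ| ρ₊` is comparable to `2 |η| |η - ξ| (1 - cos ∠(η, η - ξ))`. -/
theorem norm_mul_rhoPlus_comparable (ξ η : E2) :
    ‖ξ‖ * rhoPlus ξ η ≤
        2 * (‖η‖ * ‖η - ξ‖) * (1 - Real.cos (InnerProductGeometry.angle η (η - ξ))) ∧
      2 * (‖η‖ * ‖η - ξ‖) * (1 - Real.cos (InnerProductGeometry.angle η (η - ξ))) ≤
        2 * (‖ξ‖ * rhoPlus ξ η) := by
  have hlaw := InnerProductGeometry.norm_sub_sq_eq_norm_sq_add_norm_sq_sub_two_mul_norm_mul_norm_mul_cos_angle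
    η (η - ξ)
  rw [sub_sub_cancel] at hlaw
  have htri : |‖η‖ - ‖η - ξ‖| ≤ ‖ξ‖ := by
    simpa using abs_norm_sub_norm_le η (η - ξ)
  have hd := abs_nonneg (‖η‖ - ‖η - ξ‖)
  have hsq := sq_abs (‖η‖ - ‖η - ξ‖)
  unfold rhoPlus
  set d := |‖η‖ - ‖η - ξ‖|
  constructor <;> nlinarith [mul_nonneg hd (sub_nonneg.2 htri), sq_nonneg (‖ξ‖ - d)]

/-- There exist constants c₁, c₂ > 0 such that for all ξ, η ∈ ℝ² with η ≠ 0 and η − ξ ≠ 0,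
    c₁ · |ξ| ρ₊ / (|η| |η−ξ|) ≤ ∠(η, η−ξ)² ≤ c₂ · |ξ| ρ₊ / (|η| |η−ξ|). -/
theorem angle_sq_comparable_rhoPlus :
    ∃ c₁ c₂ : ℝ, 0 < c₁ ∧ 0 < c₂ ∧
      ∀ ξ η : E2, η ≠ 0 → η - ξ ≠ 0 →
        c₁ * (‖ξ‖ * rhoPlus ξ η / (‖η‖ * ‖η - ξ‖)) ≤
            (InnerProductGeometry.angle η (η - ξ)) ^ 2 ∧
          (InnerProductGeometry.angle η (η - ξ)) ^ 2 ≤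
            c₂ * (‖ξ‖ * rhoPlus ξ η / (‖η‖ * ‖η - ξ‖)) := by
  refine ⟨1, Real.pi ^ 2 / 2, one_pos, by positivity, fun ξ η hη hζ => ?_⟩
  have hab : 0 < ‖η‖ * ‖η - ξ‖ := mul_pos (norm_pos_iff.2 hη) (norm_pos_iff.2 hζ)
  obtain ⟨hlow, hupp⟩ := norm_mul_rhoPlus_comparable ξ η
  set θ := InnerProductGeometry.angle η (η - ξ)
  have hθ0 : 0 ≤ θ := InnerProductGeometry.angle_nonneg _ _
  have hθπ : θ ≤ Real.pi := InnerProductGeometry.angle_le_pi _ _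
  constructor
  · have hcos := Real.one_sub_sq_div_two_le_cos (x := θ)
    rw [one_mul, div_le_iff₀ hab]
    nlinarith
  · have hcos := Real.cos_le_one_sub_mul_cos_sq (abs_le.2 ⟨by linarith, hθπ⟩)
    have hquot : 1 - Real.cos θ ≤ ‖ξ‖ * rhoPlus ξ η / (‖η‖ * ‖η - ξ‖) := by
      rw [le_div_iff₀ hab]
      linarith
    calc θ ^ 2 = Real.pi ^ 2 / 2 * (2 / Real.pi ^ 2 * θ ^ 2) := by
          field_simp
      _ ≤ _ := by gcongr; linarith
end
end

section
/- There exist constants c₁, c₂, c₁′, c₂′ > 0 such that for all ξ, η ∈ ℝ² with η ≠ 0 and η − ξ ≠ 0, one has c₁ · (|η|+|η−ξ|) ρ₋ / (|η| |η−ξ|) ≤ ∠(η, ξ−η)² ≤ c₂ · (|η|+|η−ξ|) ρ₋ / (|η| |η−ξ|), and also c₁′ · ρ₋ / min(|η|, |η−ξ|) ≤ ∠(η, ξ−η)² ≤ c₂′ · ρ₋ / min(|η|, |η−ξ|). -/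
noncomputable section

/-- ρ₋ = |η| + |η−ξ| − |ξ|. -/
def rhoMinus (ξ η : E2) : ℝ := ‖η‖ + ‖η - ξ‖ - ‖ξ‖

open InnerProductGeometry in
/-- The law of cosines: `(|x| + |y|)² - |x + y|² = 2 |x| |y| (1 - cos ∠(x, y))`, factored. -/
lemma norm_add_norm_sub_norm_add_mul {V : Type*} [NormedAddCommGroup V] [InnerProductSpace ℝ V]
    (x y : V) :
    (‖x‖ + ‖y‖ - ‖x + y‖) * (‖x‖ + ‖y‖ + ‖x + y‖) =
      2 * (‖x‖ * ‖y‖) * (1 - Real.cos (angle x y)) := by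
  linear_combination -norm_add_sq_real x y + 2 * cos_angle_mul_norm_mul_norm x y

lemma sq_le_pi_sq_div_two_mul_one_sub_cos {t : ℝ} (ht : |t| ≤ Real.pi) :
    t ^ 2 ≤ Real.pi ^ 2 / 2 * (1 - Real.cos t) := by
  have h := Real.cos_le_one_sub_mul_cos_sq ht
  have hp := Real.pi_pos
  calc t ^ 2 = Real.pi ^ 2 / 2 * (2 / Real.pi ^ 2 * t ^ 2) := by field_simp
    _ ≤ _ := by gcongr; linarith

/-- `(a + b) / (a b)` is comparable to `1 / min a b`. -/
lemma div_min_le_add_mul_div_mul {a b r : ℝ} (ha : 0 < a) (hb : 0 < b) (hr : 0 ≤ r) :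
    r / min a b ≤ (a + b) * r / (a * b) ∧ (a + b) * r / (a * b) ≤ 2 * (r / min a b) := by
  have h : (a + b) * r / (a * b) = r / a + r / b := by field_simp; ring
  have h₁ := div_nonneg hr ha.le
  have h₂ := div_nonneg hr hb.le
  have hm : 0 < min a b := lt_min ha hb
  have h₃ : r / a ≤ r / min a b := div_le_div_of_nonneg_left hr hm (min_le_left a b)
  have h₄ : r / b ≤ r / min a b := div_le_div_of_nonneg_left hr hm (min_le_right a b)
  refine ⟨?_, by linarith⟩
  rcases min_choice a b with h₅ | h₅ <;> rw [h₅] <;> linarith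

/-- There exist constants c₁, c₂, c₁′, c₂′ > 0 such that for all ξ, η ∈ ℝ² with η ≠ 0 and
    η − ξ ≠ 0, one has
    c₁ (|η|+|η−ξ|) ρ₋ / (|η| |η−ξ|) ≤ ∠(η, ξ−η)² ≤ c₂ (|η|+|η−ξ|) ρ₋ / (|η| |η−ξ|)
    and c₁′ ρ₋ / min(|η|,|η−ξ|) ≤ ∠(η, ξ−η)² ≤ c₂′ ρ₋ / min(|η|,|η−ξ|). -/
theorem angle_sq_comparable_rhoMinus :
    ∃ c₁ c₂ c₁' c₂' : ℝ, 0 < c₁ ∧ 0 < c₂ ∧ 0 < c₁' ∧ 0 < c₂' ∧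
      ∀ ξ η : E2, η ≠ 0 → η - ξ ≠ 0 →
        (c₁ * ((‖η‖ + ‖η - ξ‖) * rhoMinus ξ η / (‖η‖ * ‖η - ξ‖)) ≤
            (InnerProductGeometry.angle η (ξ - η)) ^ 2 ∧
          (InnerProductGeometry.angle η (ξ - η)) ^ 2 ≤
            c₂ * ((‖η‖ + ‖η - ξ‖) * rhoMinus ξ η / (‖η‖ * ‖η - ξ‖))) ∧
        (c₁' * (rhoMinus ξ η / min ‖η‖ ‖η - ξ‖) ≤
            (InnerProductGeometry.angle η (ξ - η)) ^ 2 ∧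
          (InnerProductGeometry.angle η (ξ - η)) ^ 2 ≤
            c₂' * (rhoMinus ξ η / min ‖η‖ ‖η - ξ‖)) := by
  have hpi := Real.pi_pos
  refine ⟨1, Real.pi ^ 2 / 2, 1, Real.pi ^ 2, one_pos, by positivity, one_pos, by positivity, ?_⟩
  intro ξ η hη hξ
  have key := norm_add_norm_sub_norm_add_mul η (ξ - η)
  have htri : ‖ξ‖ ≤ ‖η‖ + ‖η - ξ‖ := by
    simpa [norm_sub_rev η ξ] using norm_add_le η (ξ - η)
  rw [add_sub_cancel, norm_sub_rev ξ η] at key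
  have hρ : 0 ≤ rhoMinus ξ η := sub_nonneg.2 htri
  change rhoMinus ξ η * _ = _ at key
  have ha : 0 < ‖η‖ := norm_pos_iff.2 hη
  have hb : 0 < ‖η - ξ‖ := norm_pos_iff.2 hξ
  have hc : 0 ≤ ‖ξ‖ := norm_nonneg ξ
  obtain ⟨hmin, hmax⟩ := div_min_le_add_mul_div_mul ha hb hρ
  set θ := InnerProductGeometry.angle η (ξ - η)
  have hcos : 1 - θ ^ 2 / 2 ≤ Real.cos θ := Real.one_sub_sq_div_two_le_cos
  have hθ : θ ^ 2 ≤ Real.pi ^ 2 / 2 * (1 - Real.cos θ) :=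
    sq_le_pi_sq_div_two_mul_one_sub_cos <| by
      rw [abs_of_nonneg (InnerProductGeometry.angle_nonneg _ _)]
      exact InnerProductGeometry.angle_le_pi _ _
  set A := (‖η‖ + ‖η - ξ‖) * rhoMinus ξ η / (‖η‖ * ‖η - ξ‖) with hA
  have hle : 1 - Real.cos θ ≤ A := by
    rw [hA, le_div_iff₀ (by positivity)]
    nlinarith [mul_le_mul_of_nonneg_left htri hρ]
  have hge : A ≤ 2 * (1 - Real.cos θ) := by
    rw [hA, div_le_iff₀ (by positivity)]
    nlinarith [mul_nonneg hρ hc]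
  have hlow : A ≤ θ ^ 2 := by linarith
  have hupp : θ ^ 2 ≤ Real.pi ^ 2 / 2 * A := hθ.trans (by gcongr)
  refine ⟨⟨by linarith, hupp⟩, by linarith, hupp.trans ?_⟩
  calc Real.pi ^ 2 / 2 * A ≤ Real.pi ^ 2 / 2 * (2 * (rhoMinus ξ η / min ‖η‖ ‖η - ξ‖)) := by gcongr
    _ = _ := by ring
end
end

section
/- There is a constant C > 0 such that for all signs s₁, s₂ ∈ {+1, −1} and all nonzero η, ζ ∈ ℝ², the operator norm on ℂ² (with its Hermitian norm) satisfies ‖Π_{s₂}(ζ) β Π_{s₁}(η)‖ ≤ C · ∠(s₁η, s₂ζ). -/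
open Matrix
noncomputable section

/-- α¹ = ((0,1),(1,0)). -/
def alpha1 : Matrix (Fin 2) (Fin 2) ℂ := !![0, 1; 1, 0]

/-- α² = ((0,−i),(i,0)). -/
def alpha2 : Matrix (Fin 2) (Fin 2) ℂ := !![0, -Complex.I; Complex.I, 0]

/-- β = ((1,0),(0,−1)). -/
def betaM : Matrix (Fin 2) (Fin 2) ℂ := !![1, 0; 0, -1]

/-- Π_s(ξ) = ½(I + s(ξ₁α¹ + ξ₂α²)/|ξ|). -/
def diracProj (s : ℝ) (ξ : E2) : Matrix (Fin 2) (Fin 2) ℂ :=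
  (1/2 : ℂ) • (1 + ((s / ‖ξ‖ : ℝ) : ℂ) • ((ξ 0 : ℂ) • alpha1 + (ξ 1 : ℂ) • alpha2))

/-- The unit complex number representing the direction of `s • ξ`. -/
def directionC (s : ℝ) (ξ : E2) : ℂ := ⟨s / ‖ξ‖ * ξ 0, s / ‖ξ‖ * ξ 1⟩

lemma diracProj_eq (s : ℝ) (ξ : E2) :
    diracProj s ξ =
      (1/2 : ℂ) • !![1, (starRingEnd ℂ) (directionC s ξ); directionC s ξ, 1] := by
  unfold diracProj alpha1 alpha2 directionC
  ext i j
  fin_cases i <;> fin_cases j <;> simp [Complex.ext_iff]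

lemma norm_directionC {s : ℝ} (hs : |s| = 1) {ξ : E2} (hξ : ξ ≠ 0) :
    ‖directionC s ξ‖ = 1 := by
  have hn : ‖ξ‖ ≠ 0 := norm_ne_zero_iff.mpr hξ
  have hs2 : s ^ 2 = 1 := by rw [← sq_abs, hs, one_pow]
  have hsq : ‖ξ‖ ^ 2 = ξ 0 ^ 2 + ξ 1 ^ 2 := by
    rw [EuclideanSpace.real_norm_sq_eq, Fin.sum_univ_two]
  have h : ‖directionC s ξ‖ ^ 2 = 1 := by
    rw [← Complex.normSq_eq_norm_sq, Complex.normSq_apply]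
    simp only [directionC]
    field_simp
    rw [hsq, hs2, one_mul]
  nlinarith [norm_nonneg (directionC s ξ)]

lemma norm_directionC_sub_le_angle {s t : ℝ} (hs : |s| = 1) (ht : |t| = 1) {ξ ζ : E2}
    (hξ : ξ ≠ 0) (hζ : ζ ≠ 0) :
    ‖directionC s ξ - directionC t ζ‖ ≤ InnerProductGeometry.angle (s • ξ) (t • ζ) := by
  have hcos : Real.cos (InnerProductGeometry.angle (s • ξ) (t • ζ)) =
      (directionC s ξ).re * (directionC t ζ).re + (directionC s ξ).im * (directionC t ζ).im := by
    rw [InnerProductGeometry.cos_angle, norm_smul, norm_smul, Real.norm_eq_abs, Real.norm_eq_abs,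
      hs, ht, PiLp.inner_apply, Fin.sum_univ_two]
    have hξn : ‖ξ‖ ≠ 0 := norm_ne_zero_iff.mpr hξ
    have hζn : ‖ζ‖ ≠ 0 := norm_ne_zero_iff.mpr hζ
    simp [directionC]
    field_simp
  have h₁ := Complex.normSq_eq_norm_sq (directionC s ξ)
  have h₂ := Complex.normSq_eq_norm_sq (directionC t ζ)
  have h₃ := Complex.normSq_eq_norm_sq (directionC s ξ - directionC t ζ)
  rw [norm_directionC hs hξ, Complex.normSq_apply] at h₁
  rw [norm_directionC ht hζ, Complex.normSq_apply] at h₂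
  rw [Complex.normSq_apply, Complex.sub_re, Complex.sub_im] at h₃
  have hle := Real.one_sub_sq_div_two_le_cos (x := InnerProductGeometry.angle (s • ξ) (t • ζ))
  refine (sq_le_sq₀ (norm_nonneg _) (InnerProductGeometry.angle_nonneg _ _)).mp ?_
  nlinarith

lemma opNorm_toEuclideanCLM_le_of_entries (M : Matrix (Fin 2) (Fin 2) ℂ) {c : ℝ} (hc : 0 ≤ c)
    (hM : ∀ i j, ‖M i j‖ ≤ c) : ‖Matrix.toEuclideanCLM (𝕜 := ℂ) M‖ ≤ 2 * c := by
  refine ContinuousLinearMap.opNorm_le_bound _ (by positivity) fun v => ?_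
  have hrow : ∀ i, ‖(Matrix.toEuclideanCLM (𝕜 := ℂ) M v) i‖ ≤ c * (‖v 0‖ + ‖v 1‖) := by
    intro i
    have hi : (Matrix.toEuclideanCLM (𝕜 := ℂ) M v) i = M i 0 * v 0 + M i 1 * v 1 := by
      rw [Matrix.ofLp_toEuclideanCLM]
      simp [Matrix.mulVec, dotProduct, Fin.sum_univ_two]
    rw [hi, mul_add]
    refine (norm_add_le _ _).trans ?_
    rw [norm_mul, norm_mul]
    gcongr <;> exact hM _ _
  have hsq : ∀ w : EuclideanSpace ℂ (Fin 2), ‖w‖ ^ 2 = ‖w 0‖ ^ 2 + ‖w 1‖ ^ 2 := fun w => by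
    rw [EuclideanSpace.norm_sq_eq, Fin.sum_univ_two]
  refine (sq_le_sq₀ (norm_nonneg _) (by positivity)).mp ?_
  have h₀ := pow_le_pow_left₀ (norm_nonneg _) (hrow 0) 2
  have h₁ := pow_le_pow_left₀ (norm_nonneg _) (hrow 1) 2
  rw [hsq, mul_pow, hsq v]
  nlinarith [mul_nonneg (sq_nonneg c) (sq_nonneg (‖v 0‖ - ‖v 1‖))]

lemma norm_diracProj_mul_beta_mul_diracProj_entry {s t : ℝ} (hs : |s| = 1) (ht : |t| = 1)
    {ξ ζ : E2} (hξ : ξ ≠ 0) (hζ : ζ ≠ 0) (i j : Fin 2) :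
    ‖(diracProj t ζ * betaM * diracProj s ξ) i j‖ = ‖directionC s ξ - directionC t ζ‖ / 4 := by
  rw [diracProj_eq, diracProj_eq]
  have hp := norm_directionC hs hξ
  have hq := norm_directionC ht hζ
  generalize directionC s ξ = p at *
  generalize directionC t ζ = q at *
  have hpp : p * (starRingEnd ℂ) p = 1 := by simp [Complex.mul_conj, Complex.normSq_eq_norm_sq, hp]
  have hqq : q * (starRingEnd ℂ) q = 1 := by simp [Complex.mul_conj, Complex.normSq_eq_norm_sq, hq]
  have key : ∀ z u : ℂ, ‖u‖ = 1 → z = u * (p - q) / 4 → ‖z‖ = ‖p - q‖ / 4 := by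
    rintro z u hu rfl
    simp [hu]
  fin_cases i <;> fin_cases j
  · refine key _ (-(starRingEnd ℂ) q) (by simpa using hq) ?_
    simp [betaM, Matrix.mul_apply, Fin.sum_univ_two]
    linear_combination (-1 / 4 : ℂ) * hqq
  · refine key _ (-((starRingEnd ℂ) p * (starRingEnd ℂ) q)) (by simp [hp, hq]) ?_
    simp [betaM, Matrix.mul_apply, Fin.sum_univ_two]
    linear_combination (1 / 4 : ℂ) * ((starRingEnd ℂ) q * hpp - (starRingEnd ℂ) p * hqq)
  · refine key _ (-1) (by simp) ?_
    simp [betaM, Matrix.mul_apply, Fin.sum_univ_two]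
    ring
  · refine key _ (-(starRingEnd ℂ) p) (by simpa using hp) ?_
    simp [betaM, Matrix.mul_apply, Fin.sum_univ_two]
    linear_combination (1 / 4 : ℂ) * hpp

/-- There is C > 0 such that for all signs s₁, s₂ ∈ {+1,−1} and all nonzero η, ζ ∈ ℝ²,
    the operator norm on ℂ² satisfies ‖Π_{s₂}(ζ) β Π_{s₁}(η)‖ ≤ C · ∠(s₁η, s₂ζ). -/
theorem diracProj_beta_opNorm_le_angle :
    ∃ C : ℝ, 0 < C ∧
      ∀ s₁ s₂ : ℝ, (s₁ = 1 ∨ s₁ = -1) → (s₂ = 1 ∨ s₂ = -1) →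
        ∀ η ζ : E2, η ≠ 0 → ζ ≠ 0 →
          ‖Matrix.toEuclideanCLM (𝕜 := ℂ) (diracProj s₂ ζ * betaM * diracProj s₁ η)‖ ≤
            C * InnerProductGeometry.angle (s₁ • η) (s₂ • ζ) := by
  refine ⟨1 / 2, by norm_num, fun s₁ s₂ h₁ h₂ η ζ hη hζ => ?_⟩
  have hs₁ : |s₁| = 1 := by rcases h₁ with rfl | rfl <;> simp
  have hs₂ : |s₂| = 1 := by rcases h₂ with rfl | rfl <;> simp
  have hop := opNorm_toEuclideanCLM_le_of_entries (diracProj s₂ ζ * betaM * diracProj s₁ η)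
    (by positivity)
    fun i j => (norm_diracProj_mul_beta_mul_diracProj_entry hs₁ hs₂ hη hζ i j).le
  linarith [norm_directionC_sub_le_angle hs₁ hs₂ hη hζ]
end
end

section
/- There is a constant c > 0 such that for every sign s ∈ {+1,−1} and every Schwartz function f on ℝ×ℝ², ‖f‖_{L⁴(ℝ×ℝ²)} ≤ c ‖f‖_{X^{5/12,1/3,1}_s} = c ∑_{k≥0} 2^{k/3} ‖⟨ξ⟩^{5/12} φ̂_k(τ + s|ξ|) f̃(τ,ξ)‖_{L²_{τ,ξ}}. -/
open MeasureTheory Complex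
open scoped RealInnerProductSpace

noncomputable section

/-- Space-time ℝ × ℝ². -/
abbrev SpaceTime : Type := ℝ × E2

/-- Space–time Fourier transform f̃(τ,ξ). -/
def ftST (f : SpaceTime → ℂ) (τ : ℝ) (ξ : E2) : ℂ :=
  ∫ p : SpaceTime, Complex.exp (-Complex.I * ((p.1 * τ + ⟪p.2, ξ⟫ : ℝ) : ℂ)) * f p

/-- Spatial Fourier transform. -/
def ftX (f : E2 → ℂ) (ξ : E2) : ℂ :=
  ∫ x : E2, Complex.exp (-Complex.I * ((⟪x, ξ⟫ : ℝ) : ℂ)) * f x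

/-- Japanese bracket ⟨x⟩ = (1+x²)^{1/2}. -/
def jap (x : ℝ) : ℝ := Real.sqrt (1 + x ^ 2)

/-- L² norm in the Fourier variables (τ,ξ). -/
def l2F (g : ℝ → E2 → ℂ) : ℝ := Real.sqrt (∫ τ : ℝ, ∫ ξ : E2, ‖g τ ξ‖ ^ 2)

/-- Classical wave-Bourgain norm ‖f‖_{X^{a,b}_s}. -/
def Xnorm (a b s : ℝ) (f : SpaceTime → ℂ) : ℝ :=
  l2F fun τ ξ => ((jap ‖ξ‖ ^ a * jap (τ + s * ‖ξ‖) ^ b : ℝ) : ℂ) * ftST f τ ξ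

/-- The hypotheses on the Littlewood–Paley bump function φ. -/
structure IsLPBump (φ : ℝ → ℝ) : Prop where
  smooth : ContDiff ℝ (⊤ : ℕ∞) φ
  compactSupport : HasCompactSupport φ
  nonneg : ∀ τ, 0 ≤ φ τ
  support_subset : ∀ τ, φ τ ≠ 0 → 1 / 2 ≤ |τ| ∧ |τ| ≤ 2
  pos : ∀ τ, 1 / Real.sqrt 2 ≤ |τ| → |τ| ≤ Real.sqrt 2 → 0 < φ τ

/-- ∑_{j∈ℤ} φ(2^{−j}τ). -/
def lpSum (φ : ℝ → ℝ) (τ : ℝ) : ℝ := ∑' j : ℤ, φ (τ / 2 ^ j)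

/-- The Littlewood–Paley pieces φ̂_k: φ̂_k(τ) = φ(2^{−k}τ)/∑_{j∈ℤ}φ(2^{−j}τ) for k ≥ 1,
    φ̂_0 = 1 − ∑_{k≥1} φ̂_k. -/
def lpPiece (φ : ℝ → ℝ) : ℕ → ℝ → ℝ
  | 0, τ => 1 - ∑' k : ℕ, φ (τ / 2 ^ (k + 1)) / lpSum φ τ
  | k + 1, τ => φ (τ / 2 ^ (k + 1)) / lpSum φ τ

/-- Bourgain–Besov norm ‖f‖_{X^{a,b,1}_s}. -/
def XnormB (φ : ℝ → ℝ) (a b s : ℝ) (f : SpaceTime → ℂ) : ℝ :=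
  ∑' k : ℕ, (2 : ℝ) ^ (b * k) *
    l2F fun τ ξ => ((jap ‖ξ‖ ^ a * lpPiece φ k (τ + s * ‖ξ‖) : ℝ) : ℂ) * ftST f τ ξ

/-- Bourgain–Besov norm ‖f‖_{X^{a,b,∞}_s}. -/
def XnormBinf (φ : ℝ → ℝ) (a b s : ℝ) (f : SpaceTime → ℂ) : ℝ :=
  ⨆ k : ℕ, (2 : ℝ) ^ (b * k) *
    l2F fun τ ξ => ((jap ‖ξ‖ ^ a * lpPiece φ k (τ + s * ‖ξ‖) : ℝ) : ℂ) * ftST f τ ξ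

/-- Mixed norm ‖f‖_{L^q_t L^r_x}. -/
def mixedNorm (q r : ℝ) (f : SpaceTime → ℂ) : ℝ :=
  (∫ t : ℝ, (∫ x : E2, ‖f (t, x)‖ ^ r) ^ (q / r)) ^ (1 / q)

/-- L² norm on the slab [0,T] × ℝ². -/
def l2Slab (T : ℝ) (f : SpaceTime → ℂ) : ℝ :=
  Real.sqrt (∫ t in Set.Icc (0 : ℝ) T, ∫ x : E2, ‖f (t, x)‖ ^ 2)

lemma focal_weight_le {r c ρ m : ℝ} (hr : 0 ≤ r) (hc : -1 ≤ c) (hc1 : c < 1) (hρ : 0 < ρ)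
    (hm : 0 < m) (hh : r < ρ + m) :
    ρ ^ (1 / 6 : ℝ) * m ^ (-5 / 6 : ℝ) ≤ (3 * 2 ^ (1 / 3 : ℝ) * (1 - c) ^ (-1 / 3 : ℝ)) *
      (1 / 3 * (ρ + m - r) ^ (-2 / 3 : ℝ) * ((ρ + m - r * c) / m)) := by
  set h := ρ + m with hdef
  have hpos : 0 < h := by positivity
  have h1c : 0 < 1 - c := by linarith
  have hA : 0 < h - r := by linarith
  have hAB : h - r ≤ h - r * c := by nlinarith
  have hB : 0 < h - r * c := by linarith
  have hhB : h * (1 - c) ≤ 2 * (h - r * c) := by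
    rcases le_or_gt 0 c with h0 | h0 <;> nlinarith
  have e1 : ρ ^ (1 / 6 : ℝ) * m ^ (-5 / 6 : ℝ) = (ρ * m) ^ (1 / 6 : ℝ) / m := by
    rw [Real.mul_rpow hρ.le hm.le, mul_div_assoc]
    congr 1
    rw [eq_div_iff hm.ne', ← Real.rpow_add_one hm.ne']
    norm_num
  have e2 : (ρ * m) ^ (1 / 6 : ℝ) ≤ h ^ (1 / 3 : ℝ) := by
    calc (ρ * m) ^ (1 / 6 : ℝ) ≤ (h ^ (2 : ℝ)) ^ (1 / 6 : ℝ) := by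
          gcongr
          rw [Real.rpow_two]
          nlinarith
      _ = h ^ (1 / 3 : ℝ) := by rw [← Real.rpow_mul hpos.le]; norm_num
  have e3 : h ^ (1 / 3 : ℝ) ≤
      2 ^ (1 / 3 : ℝ) * (h - r * c) ^ (1 / 3 : ℝ) * (1 - c) ^ (-1 / 3 : ℝ) := by
    calc h ^ (1 / 3 : ℝ) = (h * (1 - c)) ^ (1 / 3 : ℝ) * (1 - c) ^ (-1 / 3 : ℝ) := by
          rw [Real.mul_rpow hpos.le h1c.le, mul_assoc, ← Real.rpow_add h1c]
          norm_num
      _ ≤ (2 * (h - r * c)) ^ (1 / 3 : ℝ) * (1 - c) ^ (-1 / 3 : ℝ) := by gcongr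
      _ = _ := by rw [Real.mul_rpow (by norm_num) hB.le]
  have e4 : (h - r * c) ^ (1 / 3 : ℝ) ≤ (h - r) ^ (-2 / 3 : ℝ) * (h - r * c) := by
    calc (h - r * c) ^ (1 / 3 : ℝ) = (h - r * c) ^ (-2 / 3 : ℝ) * (h - r * c) := by
          rw [← Real.rpow_add_one hB.ne']; norm_num
      _ ≤ _ := by
          gcongr ?_ * _
          exact Real.rpow_le_rpow_of_nonpos hA hAB (by norm_num)
  rw [e1]
  calc (ρ * m) ^ (1 / 6 : ℝ) / m
      ≤ (2 ^ (1 / 3 : ℝ) * ((h - r) ^ (-2 / 3 : ℝ) * (h - r * c)) *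
          (1 - c) ^ (-1 / 3 : ℝ)) / m := by
        gcongr
        refine e2.trans (e3.trans ?_)
        gcongr
    _ = _ := by ring

lemma abs_rpow_third_sub_le {x y : ℝ} (hx : 0 ≤ x) (hy : 0 ≤ y) :
    |x ^ (1 / 3 : ℝ) - y ^ (1 / 3 : ℝ)| ≤ |x - y| ^ (1 / 3 : ℝ) := by
  wlog hxy : y ≤ x generalizing x y
  · rw [abs_sub_comm, abs_sub_comm x]
    exact this hy hx (le_of_not_ge hxy)
  rw [abs_of_nonneg (sub_nonneg.2 hxy), abs_of_nonneg
    (sub_nonneg.2 (Real.rpow_le_rpow hy hxy (by norm_num)))]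
  have := Real.rpow_add_le_add_rpow (p := 1 / 3) hy (sub_nonneg.2 hxy) (by norm_num) (by norm_num)
  rw [add_sub_cancel] at this
  linarith

/-- Distance from the point with polar coordinates `(ρ, θ)`, `c = cos θ`, to the point `r` of the
polar axis. -/
def focalDist (r c ρ : ℝ) : ℝ := Real.sqrt ((ρ - r) ^ 2 + 2 * ρ * r * (1 - c))

lemma continuous_focalDist (r c : ℝ) : Continuous (focalDist r c) := by
  unfold focalDist
  fun_prop

lemma focalDist_pos {r c ρ : ℝ} (hr : 0 ≤ r) (hc1 : c < 1) (hρ : 0 < ρ) :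
    0 < focalDist r c ρ ∧ r < ρ + focalDist r c ρ := by
  have h1c : 0 < 1 - c := by linarith
  rcases hr.eq_or_lt with rfl | hr'
  · have : focalDist 0 c ρ = ρ := by simp [focalDist, Real.sqrt_sq hρ.le]
    rw [this]
    exact ⟨hρ, by linarith⟩
  have key : |r - ρ| < focalDist r c ρ := by
    unfold focalDist
    rw [← Real.sqrt_sq_eq_abs]
    apply Real.sqrt_lt_sqrt (by positivity)
    have : 0 < 2 * ρ * r * (1 - c) := by positivity
    nlinarith
  exact ⟨(abs_nonneg _).trans_lt key, by linarith [le_abs_self (r - ρ)]⟩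

lemma hasDerivAt_focal {r c ρ : ℝ} (hr : 0 ≤ r) (hc1 : c < 1) (hρ : 0 < ρ) :
    HasDerivAt (fun x => (x + focalDist r c x - r) ^ (1 / 3 : ℝ))
      (1 / 3 * (ρ + focalDist r c ρ - r) ^ (-2 / 3 : ℝ) *
        ((ρ + focalDist r c ρ - r * c) / focalDist r c ρ)) ρ := by
  obtain ⟨hm, hh⟩ := focalDist_pos hr hc1 hρ
  have hq : HasDerivAt (fun x : ℝ => (x - r) ^ 2 + 2 * x * r * (1 - c))
      (2 * (ρ - r * c)) ρ := by
    have h1 := ((hasDerivAt_id' ρ).sub_const r).pow 2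
    have h2 := (((hasDerivAt_id' ρ).const_mul 2).mul_const r).mul_const (1 - c)
    refine (h1.add h2).congr_deriv ?_
    simp
    ring
  have hs : HasDerivAt (focalDist r c) ((ρ - r * c) / focalDist r c ρ) ρ := by
    have := hq.sqrt (by
      intro h0
      simp [focalDist, h0] at hm)
    refine this.congr_deriv ?_
    unfold focalDist
    rw [mul_div_mul_left _ _ two_ne_zero]
  have h1 : HasDerivAt (fun x => x + focalDist r c x - r)
      (1 + (ρ - r * c) / focalDist r c ρ) ρ := ((hasDerivAt_id' ρ).add hs).sub_const r
  refine (h1.rpow_const (p := 1 / 3) (Or.inl (by linarith))).congr_deriv ?_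
  rw [show (1 / 3 - 1 : ℝ) = -2 / 3 by norm_num]
  field_simp
  ring

lemma lintegral_ray_le {r c T M : ℝ} (hr : 0 ≤ r) (hc : -1 ≤ c) (hc1 : c < 1) :
    ∫⁻ ρ in {ρ : ℝ | 0 < ρ ∧ |ρ + focalDist r c ρ - T| ≤ M},
      ENNReal.ofReal (ρ ^ (1 / 6 : ℝ) * focalDist r c ρ ^ (-5 / 6 : ℝ)) ≤
    ENNReal.ofReal ((3 * 2 ^ (1 / 3 : ℝ) * (1 - c) ^ (-1 / 3 : ℝ)) * (2 * M) ^ (1 / 3 : ℝ)) := by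
  have h1c : 0 < 1 - c := by linarith
  set K := 3 * 2 ^ (1 / 3 : ℝ) * (1 - c) ^ (-1 / 3 : ℝ) with hK
  have hK0 : 0 ≤ K := by positivity
  set s := {ρ : ℝ | 0 < ρ ∧ |ρ + focalDist r c ρ - T| ≤ M} with hs
  have hcont := continuous_focalDist r c
  have hsm : MeasurableSet s := by
    refine MeasurableSet.inter measurableSet_Ioi ?_
    have : Continuous fun ρ => |ρ + focalDist r c ρ - T| := by fun_prop
    exact (isClosed_le this continuous_const).measurableSet
  set G : ℝ → ℝ := fun x => (x + focalDist r c x - r) ^ (1 / 3 : ℝ) with hG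
  set G' : ℝ → ℝ := fun ρ => 1 / 3 * (ρ + focalDist r c ρ - r) ^ (-2 / 3 : ℝ) *
        ((ρ + focalDist r c ρ - r * c) / focalDist r c ρ) with hG'
  have hder : ∀ ρ, 0 < ρ → HasDerivAt G (G' ρ) ρ := fun ρ hρ => hasDerivAt_focal hr hc1 hρ
  have hpos : ∀ ρ, 0 < ρ → 0 < G' ρ := by
    intro ρ hρ
    obtain ⟨hm, hh⟩ := focalDist_pos hr hc1 hρ
    have h1 : 0 < ρ + focalDist r c ρ - r := by linarith
    have h2 : 0 < ρ + focalDist r c ρ - r * c := by nlinarith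
    simp only [hG']
    positivity
  have hinj : Set.InjOn G s := by
    have : StrictMonoOn G (Set.Ioi 0) := by
      refine strictMonoOn_of_deriv_pos (convex_Ioi 0)
        (fun x hx => (hder x hx).continuousAt.continuousWithinAt) ?_
      intro x hx
      rw [interior_Ioi] at hx
      rw [(hder x hx).deriv]
      exact hpos x hx
    exact this.injOn.mono fun x hx => hx.1
  have hvol : volume (G '' s) ≤ ENNReal.ofReal ((2 * M) ^ (1 / 3 : ℝ)) := by
    refine (Real.volume_le_diam _).trans ?_
    refine Metric.ediam_le ?_
    rintro _ ⟨x, hx, rfl⟩ _ ⟨y, hy, rfl⟩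
    rw [edist_dist, Real.dist_eq]
    apply ENNReal.ofReal_le_ofReal
    have hx1 := (focalDist_pos hr hc1 hx.1).2
    have hy1 := (focalDist_pos hr hc1 hy.1).2
    refine (abs_rpow_third_sub_le (by linarith) (by linarith)).trans ?_
    gcongr
    have hx2 := abs_le.1 hx.2
    have hy2 := abs_le.1 hy.2
    rw [abs_le]
    constructor <;> linarith
  have himg := lintegral_image_eq_lintegral_abs_deriv_mul hsm
    (fun x hx => (hder x hx.1).hasDerivWithinAt) hinj 1
  simp only [Pi.one_apply, mul_one, lintegral_const, one_mul, Measure.restrict_apply_univ] at himg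
  calc ∫⁻ ρ in s, ENNReal.ofReal (ρ ^ (1 / 6 : ℝ) * focalDist r c ρ ^ (-5 / 6 : ℝ))
      ≤ ∫⁻ ρ in s, ENNReal.ofReal K * ENNReal.ofReal |G' ρ| := by
        refine setLIntegral_mono' hsm fun ρ hρ => ?_
        obtain ⟨hm, hh⟩ := focalDist_pos hr hc1 hρ.1
        rw [← ENNReal.ofReal_mul hK0, abs_of_pos (hpos ρ hρ.1)]
        exact ENNReal.ofReal_le_ofReal (focal_weight_le hr hc hc1 hρ.1 hm hh)
    _ = ENNReal.ofReal K * volume (G '' s) := by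
        rw [lintegral_const_mul' _ _ ENNReal.ofReal_ne_top, himg]
    _ ≤ _ := by
        rw [ENNReal.ofReal_mul hK0]
        gcongr

lemma exists_lintegral_one_sub_cos_le :
    ∃ A : ℝ, 0 ≤ A ∧ ∫⁻ θ in Set.Ioo (-Real.pi) Real.pi,
      ENNReal.ofReal ((1 - Real.cos θ) ^ (-1 / 3 : ℝ)) ≤ ENNReal.ofReal A := by
  have hfin : ∫⁻ θ in Set.Ioo (-Real.pi) Real.pi,
      ENNReal.ofReal ((1 - Real.cos θ) ^ (-1 / 3 : ℝ)) < ⊤ := by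
    have hpi := Real.pi_pos
    have hint : IntegrableOn (fun θ : ℝ => (2 / Real.pi ^ 2) ^ (-1 / 3 : ℝ) * |θ| ^ (-2 / 3 : ℝ))
        (Set.Ioo (-Real.pi) Real.pi) := by
      apply Integrable.const_mul
      have h1 : IntervalIntegrable (fun x : ℝ => |x| ^ (-2 / 3 : ℝ)) volume 0 Real.pi := by
        refine (intervalIntegral.intervalIntegrable_rpow' (r := -2 / 3) (by norm_num)).congr ?_
        intro x hx
        rw [Set.uIoc_of_le hpi.le] at hx
        simp [abs_of_pos hx.1]
      have h2 : IntervalIntegrable (fun x : ℝ => |x| ^ (-2 / 3 : ℝ)) volume (-Real.pi) 0 := by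
        rw [IntervalIntegrable.iff_comp_neg]
        simpa using h1.symm
      have := h2.trans h1
      rw [intervalIntegrable_iff_integrableOn_Ioo_of_le (by linarith)] at this
      exact this
    refine lt_of_le_of_lt ?_ hint.2
    refine lintegral_mono_ae ?_
    filter_upwards [ae_restrict_mem measurableSet_Ioo,
      ae_restrict_of_ae (Measure.ae_ne volume (0 : ℝ))] with θ hθ hθ0
    rw [← ofReal_norm]
    apply ENNReal.ofReal_le_ofReal
    rw [Real.norm_of_nonneg (by positivity)]
    have hcos := Real.cos_le_one_sub_mul_cos_sq (abs_le.2 ⟨hθ.1.le, hθ.2.le⟩)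
    have h3 : 0 < 2 / Real.pi ^ 2 * θ ^ 2 := by positivity
    calc (1 - Real.cos θ) ^ (-1 / 3 : ℝ) ≤ (2 / Real.pi ^ 2 * θ ^ 2) ^ (-1 / 3 : ℝ) :=
          Real.rpow_le_rpow_of_nonpos h3 (by linarith) (by norm_num)
      _ = _ := by
          rw [Real.mul_rpow (by positivity) (by positivity), ← sq_abs θ, ← Real.rpow_two |θ|,
            ← Real.rpow_mul (abs_nonneg _)]
          norm_num
  refine ⟨_, ENNReal.toReal_nonneg, (ENNReal.ofReal_toReal hfin.ne).ge⟩

lemma exists_isometry_map_norm (ξ : E2) : ∃ e : ℂ ≃ₗᵢ[ℝ] E2, e (‖ξ‖ : ℂ) = ξ := by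
  set z := Complex.orthonormalBasisOneI.repr.symm ξ with hz
  have hnz : ‖z‖ = ‖ξ‖ := LinearIsometryEquiv.norm_map _ _
  obtain ⟨u, hu⟩ : ∃ u : Circle, (u : ℂ) * (‖z‖ : ℂ) = z := by
    rcases eq_or_ne z 0 with h0 | h0
    · exact ⟨1, by simp [h0]⟩
    · refine ⟨⟨z / ‖z‖, by simp [Submonoid.unitSphere, h0]⟩, ?_⟩
      have : (‖z‖ : ℂ) ≠ 0 := by simpa using h0
      simp only
      field_simp
  refine ⟨(rotation u).trans Complex.orthonormalBasisOneI.repr, ?_⟩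
  rw [LinearIsometryEquiv.trans_apply, rotation_apply, ← hnz, hu, hz]
  exact LinearIsometryEquiv.apply_symm_apply _ _

lemma norm_sub_polarCoord {r : ℝ} (p : ℝ × ℝ) :
    ‖(r : ℂ) - Complex.polarCoord.symm p‖ = focalDist r (Real.cos p.2) p.1 := by
  rw [Complex.polarCoord_symm_apply, Complex.norm_eq_sqrt_sq_add_sq, focalDist]
  congr 1
  simp only [sub_re, sub_im, mul_re, mul_im, add_re, add_im, ofReal_re, ofReal_im, I_re, I_im]
  linear_combination p.1 ^ 2 * Real.sin_sq_add_cos_sq p.2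

/-- Weighted area of the region between two confocal ellipses with foci `0` and `ξ`. -/
lemma exists_lintegral_confocal_le :
    ∃ C : ℝ, 0 ≤ C ∧ ∀ (ξ : E2) (T M : ℝ), 0 ≤ M →
      ∫⁻ η in {η : E2 | |‖η‖ + ‖ξ - η‖ - T| ≤ M},
        ENNReal.ofReal (‖η‖ ^ (-5 / 6 : ℝ) * ‖ξ - η‖ ^ (-5 / 6 : ℝ)) ≤
      ENNReal.ofReal (C * M ^ (1 / 3 : ℝ)) := by
  obtain ⟨A, hA, hA'⟩ := exists_lintegral_one_sub_cos_le
  refine ⟨3 * 2 ^ (1 / 3 : ℝ) * 2 ^ (1 / 3 : ℝ) * A, by positivity, fun ξ T M hM => ?_⟩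
  obtain ⟨e, he⟩ := exists_isometry_map_norm ξ
  set r := ‖ξ‖ with hr
  have hr0 : 0 ≤ r := norm_nonneg _
  set S : Set ℂ := {z | |‖z‖ + ‖(r : ℂ) - z‖ - T| ≤ M} with hS
  have hSm : MeasurableSet S := by
    have : Continuous fun z : ℂ => |‖z‖ + ‖(r : ℂ) - z‖ - T| := by fun_prop
    exact (isClosed_le this continuous_const).measurableSet
  set g : ℂ → ENNReal :=
    fun z => ENNReal.ofReal (‖z‖ ^ (-5 / 6 : ℝ) * ‖(r : ℂ) - z‖ ^ (-5 / 6 : ℝ)) with hg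
  have hgm : Measurable g := by fun_prop
  have hnorm : ∀ z : ℂ, ‖ξ - e z‖ = ‖(r : ℂ) - z‖ := by
    intro z
    rw [← he, ← map_sub, e.norm_map]
  have h1 : ∫⁻ η in {η : E2 | |‖η‖ + ‖ξ - η‖ - T| ≤ M},
        ENNReal.ofReal (‖η‖ ^ (-5 / 6 : ℝ) * ‖ξ - η‖ ^ (-5 / 6 : ℝ)) =
      ∫⁻ z, S.indicator g z := by
    rw [lintegral_indicator hSm, ← e.measurePreserving.setLIntegral_comp_preimage_emb
      e.toHomeomorph.measurableEmbedding]
    simp only [Set.preimage_ofPred_eq, hnorm, e.norm_map, hS, hg]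
  rw [h1, ← Complex.lintegral_comp_polarCoord_symm]
  have hm2 : Measurable fun p : ℝ × ℝ =>
      ENNReal.ofReal p.1 • S.indicator g (Complex.polarCoord.symm p) := by
    have : Measurable (Complex.polarCoord.symm : ℝ × ℝ → ℂ) := by
      have : (Complex.polarCoord.symm : ℝ × ℝ → ℂ) =
        fun p => p.1 * (Real.cos p.2 + Real.sin p.2 * Complex.I) :=
        funext Complex.polarCoord_symm_apply
      rw [this]
      fun_prop
    exact (ENNReal.measurable_ofReal.comp measurable_fst).smul ((hgm.indicator hSm).comp this)
  rw [polarCoord_target, Measure.volume_eq_prod, ← Measure.prod_restrict,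
    lintegral_prod_symm _ hm2.aemeasurable]
  calc ∫⁻ θ in Set.Ioo (-Real.pi) Real.pi, ∫⁻ ρ in Set.Ioi (0 : ℝ),
        ENNReal.ofReal ρ • S.indicator g (Complex.polarCoord.symm (ρ, θ))
      ≤ ∫⁻ θ in Set.Ioo (-Real.pi) Real.pi,
        ENNReal.ofReal (3 * 2 ^ (1 / 3 : ℝ) * (2 * M) ^ (1 / 3 : ℝ)) *
          ENNReal.ofReal ((1 - Real.cos θ) ^ (-1 / 3 : ℝ)) := by
        refine lintegral_mono_ae ?_
        filter_upwards [ae_restrict_mem measurableSet_Ioo,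
          ae_restrict_of_ae (Measure.ae_ne volume (0 : ℝ))] with θ hθ hθ0
        have hc1 : Real.cos θ < 1 := by
          refine lt_of_le_of_ne (Real.cos_le_one θ) fun h => hθ0 ?_
          exact (Real.cos_eq_one_iff_of_lt_of_lt (by linarith [hθ.1, Real.pi_pos])
            (by linarith [hθ.2, Real.pi_pos])).1 h
        rw [← ENNReal.ofReal_mul (by positivity)]
        convert lintegral_ray_le (T := T) (M := M) hr0 (Real.neg_one_le_cos θ) hc1 using 1
        · have hSm' : MeasurableSet {ρ : ℝ | |ρ + focalDist r (Real.cos θ) ρ - T| ≤ M} := by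
            have hcont := continuous_focalDist r (Real.cos θ)
            have : Continuous fun ρ => |ρ + focalDist r (Real.cos θ) ρ - T| := by fun_prop
            exact (isClosed_le this continuous_const).measurableSet
          rw [show {ρ : ℝ | 0 < ρ ∧ |ρ + focalDist r (Real.cos θ) ρ - T| ≤ M} =
            {ρ : ℝ | |ρ + focalDist r (Real.cos θ) ρ - T| ≤ M} ∩ Set.Ioi 0 by
              ext; simp [and_comm], ← Measure.restrict_restrict hSm', ← lintegral_indicator hSm']
          refine setLIntegral_congr_fun measurableSet_Ioi fun ρ hρ => ?_
          have hρ' : 0 < ρ := hρ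
          simp only [Set.indicator_apply, hS, Set.mem_ofPred_eq, norm_sub_polarCoord,
            Complex.norm_polarCoord_symm, abs_of_pos hρ', hg]
          split_ifs
          · rw [smul_eq_mul, ← ENNReal.ofReal_mul hρ'.le, ← mul_assoc]
            congr 2
            rw [mul_comm, ← Real.rpow_add_one hρ'.ne']
            norm_num
          · simp
        · congr 1
          ring
    _ ≤ ENNReal.ofReal (3 * 2 ^ (1 / 3 : ℝ) * (2 * M) ^ (1 / 3 : ℝ)) * ENNReal.ofReal A := by
        rw [lintegral_const_mul' _ _ ENNReal.ofReal_ne_top]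
        gcongr
    _ = _ := by
        rw [← ENNReal.ofReal_mul (by positivity), Real.mul_rpow (by norm_num) hM]
        congr 1
        ring

lemma jap_pos (x : ℝ) : 0 < jap x := Real.sqrt_pos.2 (by positivity)

lemma one_le_jap (x : ℝ) : 1 ≤ jap x := by
  rw [jap, Real.one_le_sqrt]
  nlinarith [sq_nonneg x]

lemma le_jap (x : ℝ) : x ≤ jap x := Real.le_sqrt_of_sq_le (by linarith)

lemma continuous_jap : Continuous jap := by
  unfold jap
  fun_prop

/-- The `L`-neighbourhood, in the modulation variable, of the cone `τ = -s|ξ|`. -/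
def coneNhd (s L : ℝ) : Set SpaceTime := {p | |p.1 + s * ‖p.2‖| ≤ L}

lemma measurableSet_coneNhd (s L : ℝ) : MeasurableSet (coneNhd s L) := by
  have : Continuous fun p : SpaceTime => |p.1 + s * ‖p.2‖| := by fun_prop
  exact (isClosed_le this continuous_const).measurableSet

lemma min_mul_rpow_add_le {a b : ℝ} (ha : 0 < a) (hb : 0 < b) :
    2 * min a b * (a + b) ^ (1 / 3 : ℝ) ≤ 4 * (a * b) ^ (2 / 3 : ℝ) := by
  wlog hab : a ≤ b generalizing a b
  · rw [min_comm, add_comm, mul_comm a]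
    exact this hb ha (le_of_not_ge hab)
  rw [min_eq_left hab]
  have h2 : (2 : ℝ) ^ (1 / 3 : ℝ) ≤ 2 := by
    simpa using Real.rpow_le_rpow_of_exponent_le (x := 2) (y := 1 / 3) (z := 1)
      (by norm_num) (by norm_num)
  calc 2 * a * (a + b) ^ (1 / 3 : ℝ) ≤ 2 * a * (2 * b) ^ (1 / 3 : ℝ) := by
        gcongr
        linarith
    _ = 2 * 2 ^ (1 / 3 : ℝ) * (a ^ (2 / 3 : ℝ) * a ^ (1 / 3 : ℝ) * b ^ (1 / 3 : ℝ)) := by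
        rw [← Real.rpow_add ha, Real.mul_rpow (by norm_num) hb.le]
        norm_num
        ring
    _ ≤ 2 * 2 * (a ^ (2 / 3 : ℝ) * b ^ (1 / 3 : ℝ) * b ^ (1 / 3 : ℝ)) := by gcongr
    _ = _ := by
        rw [mul_assoc (a ^ (2 / 3 : ℝ)), ← Real.rpow_add hb, Real.mul_rpow ha.le hb.le]
        norm_num

lemma exists_lintegral_cone_inter_le :
    ∃ C : ℝ, 0 ≤ C ∧ ∀ (s : ℝ), (s = 1 ∨ s = -1) → ∀ (L₁ L₂ : ℝ), 0 < L₁ → 0 < L₂ →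
      ∀ x : SpaceTime,
      ∫⁻ y in {y | y ∈ coneNhd s L₁ ∧ x - y ∈ coneNhd s L₂},
        ENNReal.ofReal (jap ‖y.2‖ ^ (-5 / 6 : ℝ) * jap ‖(x - y).2‖ ^ (-5 / 6 : ℝ)) ≤
      ENNReal.ofReal (C * (L₁ * L₂) ^ (2 / 3 : ℝ)) := by
  obtain ⟨C, hC, hC'⟩ := exists_lintegral_confocal_le
  refine ⟨4 * C, by positivity, fun s hs L₁ L₂ h₁ h₂ ⟨t, ξ⟩ => ?_⟩
  have hjap := continuous_jap
  set J : Set SpaceTime := {y | y ∈ coneNhd s L₁ ∧ (t, ξ) - y ∈ coneNhd s L₂} with hJ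
  have hJm : MeasurableSet J := (measurableSet_coneNhd s L₁).inter
    (measurable_const.sub measurable_id (measurableSet_coneNhd s L₂))
  set w : E2 → ENNReal := fun η =>
    ENNReal.ofReal (jap ‖η‖ ^ (-5 / 6 : ℝ) * jap ‖ξ - η‖ ^ (-5 / 6 : ℝ)) with hw
  have hwm : Measurable w := by
    have h1 := hjap.measurable
    fun_prop
  set B : Set E2 := {η | |‖η‖ + ‖ξ - η‖ - -s * t| ≤ L₁ + L₂} with hB
  have hBm : MeasurableSet B := by
    have : Continuous fun η : E2 => |‖η‖ + ‖ξ - η‖ - -s * t| := by fun_prop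
    exact (isClosed_le this continuous_const).measurableSet
  have hinner : ∀ η : E2, ∫⁻ τ : ℝ, J.indicator (fun y => w y.2) (τ, η) ≤
      B.indicator (fun η => ENNReal.ofReal (2 * min L₁ L₂) * w η) η := by
    intro η
    set Jη : Set ℝ := {τ | (τ, η) ∈ J} with hJη
    have hJηm : MeasurableSet Jη := measurable_prodMk_right hJm
    have e1 : ∫⁻ τ : ℝ, J.indicator (fun y => w y.2) (τ, η) = w η * volume Jη := by
      rw [← lintegral_indicator_const hJηm]
      rfl
    have hv1 : volume Jη ≤ ENNReal.ofReal (2 * min L₁ L₂) := by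
      rcases min_choice L₁ L₂ with h | h
      · rw [h, show 2 * L₁ = (-s * ‖η‖ + L₁) - (-s * ‖η‖ - L₁) by ring, ← Real.volume_Icc]
        refine measure_mono fun τ hτ => ?_
        have := abs_le.1 (show |τ + s * ‖η‖| ≤ L₁ from hτ.1)
        constructor <;> linarith
      · rw [h, show 2 * L₂ = (t + s * ‖ξ - η‖ + L₂) - (t + s * ‖ξ - η‖ - L₂) by ring,
          ← Real.volume_Icc]
        refine measure_mono fun τ hτ => ?_
        have := abs_le.1 (show |t - τ + s * ‖ξ - η‖| ≤ L₂ from hτ.2)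
        constructor <;> linarith
    rw [e1]
    by_cases hη : η ∈ B
    · rw [Set.indicator_of_mem hη, mul_comm]
      gcongr
    · have : Jη = ∅ := by
        refine Set.eq_empty_of_forall_notMem fun τ hτ => hη ?_
        have a1 := abs_le.1 (show |τ + s * ‖η‖| ≤ L₁ from hτ.1)
        have a2 := abs_le.1 (show |t - τ + s * ‖ξ - η‖| ≤ L₂ from hτ.2)
        change |‖η‖ + ‖ξ - η‖ - -s * t| ≤ L₁ + L₂
        rw [abs_le]
        rcases hs with rfl | rfl <;> constructor <;> linarith
      simp [this]
  calc ∫⁻ y in J, ENNReal.ofReal (jap ‖y.2‖ ^ (-5 / 6 : ℝ) * jap ‖((t, ξ) - y).2‖ ^ (-5 / 6 : ℝ))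
      = ∫⁻ y : SpaceTime, J.indicator (fun y => w y.2) y := by rw [lintegral_indicator hJm]; rfl
    _ = ∫⁻ η : E2, ∫⁻ τ : ℝ, J.indicator (fun y => w y.2) (τ, η) := by
        rw [Measure.volume_eq_prod]
        exact lintegral_prod_symm _ ((hwm.comp measurable_snd).indicator hJm).aemeasurable
    _ ≤ ∫⁻ η : E2, B.indicator (fun η => ENNReal.ofReal (2 * min L₁ L₂) * w η) η :=
        lintegral_mono hinner
    _ = ENNReal.ofReal (2 * min L₁ L₂) * ∫⁻ η in B, w η := by
        rw [lintegral_indicator hBm, lintegral_const_mul' _ _ ENNReal.ofReal_ne_top]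
    _ ≤ ENNReal.ofReal (2 * min L₁ L₂) * ∫⁻ η in B,
          ENNReal.ofReal (‖η‖ ^ (-5 / 6 : ℝ) * ‖ξ - η‖ ^ (-5 / 6 : ℝ)) := by
        refine mul_le_mul' le_rfl ?_
        refine lintegral_mono_ae ?_
        filter_upwards [ae_restrict_of_ae (Measure.ae_ne volume (0 : E2)),
          ae_restrict_of_ae (Measure.ae_ne volume ξ)] with η h0 hξ
        apply ENNReal.ofReal_le_ofReal
        have n1 : 0 < ‖η‖ := norm_pos_iff.2 h0
        have n2 : 0 < ‖ξ - η‖ := norm_pos_iff.2 (sub_ne_zero.2 hξ.symm)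
        have := jap_pos ‖ξ - η‖
        gcongr ?_ * ?_
        · exact Real.rpow_le_rpow_of_nonpos n1 (le_jap _) (by norm_num)
        · exact Real.rpow_le_rpow_of_nonpos n2 (le_jap _) (by norm_num)
    _ ≤ ENNReal.ofReal (2 * min L₁ L₂) * ENNReal.ofReal (C * (L₁ + L₂) ^ (1 / 3 : ℝ)) := by
        refine mul_le_mul' le_rfl ?_
        exact hC' ξ (-s * t) (L₁ + L₂) (by positivity)
    _ ≤ _ := by
        rw [← ENNReal.ofReal_mul (by positivity)]
        apply ENNReal.ofReal_le_ofReal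
        nlinarith [min_mul_rpow_add_le h₁ h₂]

lemma sq_lintegral_mul_le {α : Type*} [MeasurableSpace α] {μ : Measure α} {f g : α → ENNReal}
    (hf : AEMeasurable f μ) (hg : AEMeasurable g μ) :
    (∫⁻ x, f x * g x ∂μ) ^ 2 ≤ (∫⁻ x, f x ^ 2 ∂μ) * ∫⁻ x, g x ^ 2 ∂μ := by
  have h := ENNReal.lintegral_mul_le_Lp_mul_Lq μ Real.HolderConjugate.two_two hf hg
  have h2 := ENNReal.rpow_le_rpow h (z := 2) (by norm_num)
  rw [ENNReal.mul_rpow_of_nonneg _ _ (by norm_num), ← ENNReal.rpow_mul, ← ENNReal.rpow_mul] at h2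
  norm_num at h2
  exact h2

lemma sqrt_lintegral_sq_tsum_le {α : Type*} [MeasurableSpace α] {μ : Measure α}
    {u : ℕ → α → ENNReal} (hu : ∀ n, Measurable (u n)) :
    (∫⁻ x, (∑' n, u n x) ^ 2 ∂μ) ^ (1 / 2 : ℝ) ≤
      ∑' n, (∫⁻ x, u n x ^ 2 ∂μ) ^ (1 / 2 : ℝ) := by
  have hfin : ∀ N : ℕ, (∫⁻ x, (∑ n ∈ Finset.range N, u n x) ^ 2 ∂μ) ^ (1 / 2 : ℝ) ≤
      ∑ n ∈ Finset.range N, (∫⁻ x, u n x ^ 2 ∂μ) ^ (1 / 2 : ℝ) := by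
    intro N
    induction N with
    | zero => simp
    | succ N ih =>
      simp only [Finset.sum_range_succ]
      refine le_trans ?_ (add_le_add_left ih _)
      have := ENNReal.lintegral_Lp_add_le (μ := μ) (p := 2)
        (f := fun x => ∑ n ∈ Finset.range N, u n x) (g := u N)
        (Finset.measurable_fun_sum _ fun n _ => hu n).aemeasurable (hu N).aemeasurable (by norm_num)
      simpa using this
  have hsq : (∫⁻ x, (∑' n, u n x) ^ 2 ∂μ) =
      ⨆ N : ℕ, ∫⁻ x, (∑ n ∈ Finset.range N, u n x) ^ 2 ∂μ := by
    rw [← lintegral_iSup]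
    · congr 1 with x
      rw [ENNReal.tsum_eq_iSup_nat]
      exact (show Monotone fun a : ENNReal => a ^ 2 from fun a b h => by simp only; gcongr).map_iSup_of_continuousAt (ENNReal.continuous_pow 2).continuousAt
        (by simp)
    · exact fun N => (Finset.measurable_fun_sum _ fun n _ => hu n).pow_const 2
    · intro a b hab x
      simp only
      gcongr
  rw [one_div, ENNReal.rpow_inv_le_iff (by norm_num), hsq]
  refine iSup_le fun N => ?_
  rw [← ENNReal.rpow_inv_le_iff (by norm_num), ← one_div]
  exact (hfin N).trans (ENNReal.sum_le_tsum _)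

/-- Elliptic bilinear estimate for functions supported near the cone. -/
lemma exists_bilinear_le :
    ∃ C : ℝ, 0 ≤ C ∧ ∀ (s : ℝ), (s = 1 ∨ s = -1) → ∀ (L₁ L₂ : ℝ), 0 < L₁ → 0 < L₂ →
      ∀ F G : SpaceTime → ENNReal, Measurable F → Measurable G →
      (∀ p, p ∉ coneNhd s L₁ → F p = 0) → (∀ p, p ∉ coneNhd s L₂ → G p = 0) →
      ∫⁻ x, (∫⁻ y, F y * G (x - y)) ^ 2 ≤ ENNReal.ofReal (C * (L₁ * L₂) ^ (2 / 3 : ℝ)) *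
        ((∫⁻ p : SpaceTime, (ENNReal.ofReal (jap ‖p.2‖ ^ (5 / 12 : ℝ)) * F p) ^ 2) *
          ∫⁻ p : SpaceTime, (ENNReal.ofReal (jap ‖p.2‖ ^ (5 / 12 : ℝ)) * G p) ^ 2) := by
  obtain ⟨C, hC, hC'⟩ := exists_lintegral_cone_inter_le
  refine ⟨C, hC, fun s hs L₁ L₂ h₁ h₂ F G hF hG hFs hGs => ?_⟩
  have hjap := continuous_jap.measurable
  set W : SpaceTime → ENNReal := fun p => ENNReal.ofReal (jap ‖p.2‖ ^ (5 / 12 : ℝ)) with hW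
  set V : SpaceTime → ENNReal := fun p => ENNReal.ofReal (jap ‖p.2‖ ^ (-5 / 12 : ℝ)) with hV
  have hWm : Measurable W := by fun_prop
  have hVm : Measurable V := by fun_prop
  have hWV : ∀ p, W p * V p = 1 := by
    intro p
    have := jap_pos ‖p.2‖
    rw [hW, hV, ← ENNReal.ofReal_mul (by positivity), ← Real.rpow_add this]
    norm_num
  have hV2 : ∀ p q, (V p * V q) ^ 2 =
      ENNReal.ofReal (jap ‖p.2‖ ^ (-5 / 6 : ℝ) * jap ‖q.2‖ ^ (-5 / 6 : ℝ)) := by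
    intro p q
    have hp := jap_pos ‖p.2‖
    have hq := jap_pos ‖q.2‖
    rw [hV, ← ENNReal.ofReal_mul (by positivity), ← ENNReal.ofReal_pow (by positivity), mul_pow,
      ← Real.rpow_mul_natCast hp.le, ← Real.rpow_mul_natCast hq.le]
    norm_num
  have hpt : ∀ x, (∫⁻ y, F y * G (x - y)) ^ 2 ≤
      (∫⁻ y, (W y * F y) ^ 2 * (W (x - y) * G (x - y)) ^ 2) *
        ENNReal.ofReal (C * (L₁ * L₂) ^ (2 / 3 : ℝ)) := by
    intro x
    set J : Set SpaceTime := {y | y ∈ coneNhd s L₁ ∧ x - y ∈ coneNhd s L₂} with hJ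
    have hJm : MeasurableSet J := (measurableSet_coneNhd s L₁).inter
      (measurable_const.sub measurable_id (measurableSet_coneNhd s L₂))
    have e1 : ∀ y, F y * G (x - y) = (W y * F y * (W (x - y) * G (x - y))) *
        J.indicator (fun y => V y * V (x - y)) y := by
      intro y
      by_cases hy : y ∈ J
      · rw [Set.indicator_of_mem hy]
        calc F y * G (x - y) = (W y * V y) * (W (x - y) * V (x - y)) * (F y * G (x - y)) := by
              rw [hWV, hWV, one_mul, one_mul]
          _ = _ := by ring
      · rw [Set.indicator_of_notMem hy, mul_zero]
        by_cases hy1 : y ∈ coneNhd s L₁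
        · rw [hGs _ fun h => hy ⟨hy1, h⟩, mul_zero]
        · rw [hFs _ hy1, zero_mul]
    simp_rw [e1]
    refine (sq_lintegral_mul_le (by fun_prop) ?_).trans ?_
    · exact ((by fun_prop : Measurable fun y => V y * V (x - y)).indicator hJm).aemeasurable
    · simp_rw [mul_pow (W _ * F _)]
      refine mul_le_mul' le_rfl ?_
      refine le_trans (le_of_eq ?_) (hC' s hs L₁ L₂ h₁ h₂ x)
      rw [← lintegral_indicator hJm]
      congr 1 with y
      by_cases hy : y ∈ J
      · rw [Set.indicator_of_mem hy, Set.indicator_of_mem hy, hV2]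
      · rw [Set.indicator_of_notMem hy, Set.indicator_of_notMem hy]
        simp
  calc ∫⁻ x, (∫⁻ y, F y * G (x - y)) ^ 2
      ≤ ∫⁻ x, (∫⁻ y, (W y * F y) ^ 2 * (W (x - y) * G (x - y)) ^ 2) *
        ENNReal.ofReal (C * (L₁ * L₂) ^ (2 / 3 : ℝ)) := lintegral_mono hpt
    _ = ENNReal.ofReal (C * (L₁ * L₂) ^ (2 / 3 : ℝ)) *
        ∫⁻ x, (∫⁻ y, (W y * F y) ^ 2 * (W (x - y) * G (x - y)) ^ 2) := by
        rw [lintegral_mul_const' _ _ ENNReal.ofReal_ne_top, mul_comm]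
    _ = _ := by
        congr 1
        rw [lintegral_lintegral_swap (by fun_prop), ← lintegral_mul_const _ (by fun_prop)]
        congr 1 with y
        rw [lintegral_const_mul _ (by fun_prop)]
        congr 1
        have : (volume : Measure SpaceTime).IsAddHaarMeasure :=
          Measure.prod.instIsAddHaarMeasure volume volume
        exact lintegral_sub_right_eq_self (fun x => (W x * G x) ^ 2) y

lemma exists_convolution_tsum_le :
    ∃ C : ℝ, 0 ≤ C ∧ ∀ (s : ℝ), (s = 1 ∨ s = -1) → ∀ F : ℕ → SpaceTime → ENNReal,
      (∀ k, Measurable (F k)) → (∀ k p, p ∉ coneNhd s (2 ^ (k + 1)) → F k p = 0) →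
      (∫⁻ x, (∫⁻ y, (∑' k, F k y) * ∑' k, F k (x - y)) ^ 2) ^ (1 / 2 : ℝ) ≤
        ENNReal.ofReal C * (∑' k : ℕ, ENNReal.ofReal ((2 : ℝ) ^ (1 / 3 * k : ℝ)) *
          (∫⁻ p : SpaceTime, (ENNReal.ofReal (jap ‖p.2‖ ^ (5 / 12 : ℝ)) * F k p) ^ 2) ^
            (1 / 2 : ℝ)) ^ 2 := by
  obtain ⟨C, hC, hC'⟩ := exists_bilinear_le
  refine ⟨C ^ (1 / 2 : ℝ) * 2 ^ (2 / 3 : ℝ), by positivity, fun s hs F hF hFs => ?_⟩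
  set N : ℕ → ENNReal := fun k =>
    (∫⁻ p : SpaceTime, (ENNReal.ofReal (jap ‖p.2‖ ^ (5 / 12 : ℝ)) * F k p) ^ 2) ^ (1 / 2 : ℝ)
    with hN
  have hpair : ∀ j k, (∫⁻ x, (∫⁻ y, F j y * F k (x - y)) ^ 2) ^ (1 / 2 : ℝ) ≤
      ENNReal.ofReal (C ^ (1 / 2 : ℝ) * 2 ^ (2 / 3 : ℝ)) *
        ((ENNReal.ofReal ((2 : ℝ) ^ (1 / 3 * j : ℝ)) * N j) *
          (ENNReal.ofReal ((2 : ℝ) ^ (1 / 3 * k : ℝ)) * N k)) := by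
    intro j k
    have h := ENNReal.rpow_le_rpow (hC' s hs (2 ^ (j + 1)) (2 ^ (k + 1)) (by positivity)
      (by positivity) (F j) (F k) (hF j) (hF k) (hFs j) (hFs k)) (z := 1 / 2) (by norm_num)
    refine h.trans (le_of_eq ?_)
    rw [ENNReal.mul_rpow_of_nonneg _ _ (by norm_num), ENNReal.mul_rpow_of_nonneg _ _ (by norm_num),
      ENNReal.ofReal_rpow_of_nonneg (by positivity) (by norm_num)]
    have hc : (C * ((2 : ℝ) ^ (j + 1) * 2 ^ (k + 1)) ^ (2 / 3 : ℝ)) ^ (1 / 2 : ℝ) =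
        C ^ (1 / 2 : ℝ) * 2 ^ (2 / 3 : ℝ) *
          ((2 : ℝ) ^ (1 / 3 * j : ℝ) * (2 : ℝ) ^ (1 / 3 * k : ℝ)) := by
      rw [Real.mul_rpow hC (by positivity), ← Real.rpow_mul (by positivity), mul_assoc, ← pow_add,
        ← Real.rpow_natCast_mul (by norm_num), ← Real.rpow_add (by norm_num),
        ← Real.rpow_add (by norm_num)]
      congr 2
      push_cast
      ring
    rw [hc, ENNReal.ofReal_mul (by positivity),
      ENNReal.ofReal_mul (p := (2 : ℝ) ^ (1 / 3 * j : ℝ)) (by positivity)]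
    change _ * (N j * N k) = _
    ring
  have hmeas : ∀ j k, Measurable fun x => ∫⁻ y, F j y * F k (x - y) := by
    intro j k
    have h1 := hF j
    have h2 := hF k
    apply Measurable.lintegral_prod_right
    fun_prop
  have hexp : ∀ x, ∫⁻ y, (∑' k, F k y) * ∑' k, F k (x - y) =
      ∑' j, ∑' k, ∫⁻ y, F j y * F k (x - y) := by
    intro x
    have hm : ∀ k, Measurable fun y => F k (x - y) :=
      fun k => (hF k).comp (measurable_const.sub measurable_id)
    simp_rw [← ENNReal.tsum_mul_right, ← ENNReal.tsum_mul_left]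
    have hm' : ∀ j k, Measurable fun y => F j y * F k (x - y) := fun j k => (hF j).mul (hm k)
    rw [lintegral_tsum fun j => (Measurable.tsum (hm' j)).aemeasurable]
    exact tsum_congr fun j => lintegral_tsum fun k => (hm' j k).aemeasurable
  simp_rw [hexp]
  calc _ ≤ ∑' j, (∫⁻ x, (∑' k, ∫⁻ y, F j y * F k (x - y)) ^ 2) ^ (1 / 2 : ℝ) :=
        sqrt_lintegral_sq_tsum_le fun j => Measurable.tsum (hmeas j)
    _ ≤ ∑' j, ∑' k, (∫⁻ x, (∫⁻ y, F j y * F k (x - y)) ^ 2) ^ (1 / 2 : ℝ) :=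
        ENNReal.tsum_le_tsum fun j => sqrt_lintegral_sq_tsum_le (hmeas j)
    _ ≤ ∑' j : ℕ, ∑' k : ℕ, ENNReal.ofReal (C ^ (1 / 2 : ℝ) * 2 ^ (2 / 3 : ℝ)) *
        ((ENNReal.ofReal ((2 : ℝ) ^ (1 / 3 * j : ℝ)) * N j) *
          (ENNReal.ofReal ((2 : ℝ) ^ (1 / 3 * k : ℝ)) * N k)) :=
        ENNReal.tsum_le_tsum fun j => ENNReal.tsum_le_tsum fun k => hpair j k
    _ = _ := by
        simp_rw [ENNReal.tsum_mul_left, ENNReal.tsum_mul_right]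
        rw [sq]

namespace IsLPBump

variable {φ : ℝ → ℝ}

lemma dyadic_bounds (hφ : IsLPBump φ) {τ : ℝ} {j : ℤ} (h : φ (τ / 2 ^ j) ≠ 0) :
    2 ^ (j - 1) ≤ |τ| ∧ |τ| ≤ 2 ^ (j + 1) := by
  obtain ⟨h1, h2⟩ := hφ.support_subset _ h
  have hj : (0 : ℝ) < 2 ^ j := by positivity
  rw [abs_div, abs_of_pos hj] at h1 h2
  rw [le_div_iff₀ hj] at h1
  rw [div_le_iff₀ hj] at h2
  rw [zpow_sub_one₀ two_ne_zero, zpow_add_one₀ two_ne_zero]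
  constructor <;> linarith

lemma map_zero (hφ : IsLPBump φ) : φ 0 = 0 := by
  by_contra h
  have := (hφ.support_subset 0 h).1
  norm_num at this

lemma summable_dyadic (hφ : IsLPBump φ) (τ : ℝ) : Summable fun j : ℤ => φ (τ / 2 ^ j) := by
  rcases eq_or_ne τ 0 with rfl | hτ
  · simp [hφ.map_zero, summable_zero]
  obtain ⟨n, hn1, hn2⟩ := exists_mem_Ico_zpow (abs_pos.2 hτ) one_lt_two
  refine summable_of_ne_finset_zero (s := Finset.Icc (n - 1) (n + 1)) fun j hj => ?_
  by_contra h
  obtain ⟨h1, h2⟩ := hφ.dyadic_bounds h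
  have a1 := (zpow_lt_zpow_iff_right₀ (one_lt_two (α := ℝ))).1 (h1.trans_lt hn2)
  have a2 := (zpow_le_zpow_iff_right₀ (one_lt_two (α := ℝ))).1 (hn1.trans h2)
  apply hj
  rw [Finset.mem_Icc]
  omega

lemma lpSum_nonneg (hφ : IsLPBump φ) (τ : ℝ) : 0 ≤ lpSum φ τ := tsum_nonneg fun _ => hφ.nonneg _

lemma lpSum_pos (hφ : IsLPBump φ) {τ : ℝ} (hτ : τ ≠ 0) : 0 < lpSum φ τ := by
  have h2 : 0 < Real.sqrt 2 := by positivity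
  have hss : Real.sqrt 2 * Real.sqrt 2 = 2 := Real.mul_self_sqrt (by norm_num)
  obtain ⟨j, hj1, hj2⟩ := exists_mem_Ico_zpow (mul_pos h2 (abs_pos.2 hτ)) one_lt_two
  rw [zpow_add_one₀ two_ne_zero] at hj2
  have hj : (0 : ℝ) < 2 ^ j := by positivity
  refine (hφ.summable_dyadic τ).tsum_pos (fun _ => hφ.nonneg _) j (hφ.pos _ ?_ ?_)
  · rw [abs_div, abs_of_pos hj, div_le_div_iff₀ h2 hj]
    linarith
  · rw [abs_div, abs_of_pos hj, div_le_iff₀ hj]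
    nlinarith

lemma summable_dyadic_nat (hφ : IsLPBump φ) (τ : ℝ) :
    Summable fun k : ℕ => φ (τ / 2 ^ (k + 1)) := by
  have := (hφ.summable_dyadic τ).comp_injective
    (i := fun k : ℕ => ((k + 1 : ℕ) : ℤ)) fun a b h => by simpa using h
  simpa only [Function.comp_def, zpow_natCast] using this

lemma tsum_dyadic_nat_le (hφ : IsLPBump φ) (τ : ℝ) :
    ∑' k : ℕ, φ (τ / 2 ^ (k + 1)) ≤ lpSum φ τ := by
  have := tsum_comp_le_tsum_of_inj (hφ.summable_dyadic τ) (fun _ => hφ.nonneg _)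
    (i := fun k : ℕ => ((k + 1 : ℕ) : ℤ)) fun a b h => by simpa using h
  simpa only [Function.comp_def, zpow_natCast, lpSum] using this

lemma tsum_dyadic_nat_eq (hφ : IsLPBump φ) {τ : ℝ} (hτ : 2 < |τ|) :
    ∑' k : ℕ, φ (τ / 2 ^ (k + 1)) = lpSum φ τ := by
  have hinj : Function.Injective fun k : ℕ => ((k + 1 : ℕ) : ℤ) := fun a b h => by simpa using h
  have := hinj.tsum_eq (f := fun j : ℤ => φ (τ / 2 ^ j)) (by
    intro j hj
    obtain ⟨-, h2⟩ := hφ.dyadic_bounds hj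
    have h3 : (2 : ℝ) ^ (1 : ℤ) < 2 ^ (j + 1) := by simpa using hτ.trans_le h2
    have := (zpow_lt_zpow_iff_right₀ (one_lt_two (α := ℝ))).1 h3
    exact ⟨(j - 1).toNat, by simp only; omega⟩)
  simpa only [zpow_natCast, lpSum] using this

lemma summable_lpPiece_succ (hφ : IsLPBump φ) (τ : ℝ) : Summable fun k : ℕ => lpPiece φ (k + 1) τ :=
  (hφ.summable_dyadic_nat τ).div_const _

lemma lpPiece_zero_eq (τ : ℝ) : lpPiece φ 0 τ = 1 - ∑' k : ℕ, lpPiece φ (k + 1) τ := rfl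

lemma lpPiece_nonneg (hφ : IsLPBump φ) (k : ℕ) (τ : ℝ) : 0 ≤ lpPiece φ k τ := by
  cases k with
  | zero =>
    rw [lpPiece, tsum_div_const, sub_nonneg]
    exact div_le_one_of_le₀ (hφ.tsum_dyadic_nat_le τ) (hφ.lpSum_nonneg τ)
  | succ k => exact div_nonneg (hφ.nonneg _) (hφ.lpSum_nonneg τ)

lemma hasSum_lpPiece (hφ : IsLPBump φ) (τ : ℝ) : HasSum (fun k => lpPiece φ k τ) 1 := by
  have h := (hφ.summable_lpPiece_succ τ).hasSum
  rw [← hasSum_nat_add_iff' 1]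
  simpa [lpPiece_zero_eq] using h

lemma lpPiece_le_one (hφ : IsLPBump φ) (k : ℕ) (τ : ℝ) : lpPiece φ k τ ≤ 1 :=
  le_hasSum (hφ.hasSum_lpPiece τ) k fun _ _ => hφ.lpPiece_nonneg _ _

lemma tsum_ofReal_lpPiece (hφ : IsLPBump φ) (τ : ℝ) :
    ∑' k, ENNReal.ofReal (lpPiece φ k τ) = 1 := by
  rw [← ENNReal.ofReal_tsum_of_nonneg (fun k => hφ.lpPiece_nonneg k τ)
    (hφ.hasSum_lpPiece τ).summable, (hφ.hasSum_lpPiece τ).tsum_eq, ENNReal.ofReal_one]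

lemma lpPiece_succ_ne_zero (hφ : IsLPBump φ) {k : ℕ} {τ : ℝ} (h : lpPiece φ (k + 1) τ ≠ 0) :
    2 ^ k ≤ |τ| ∧ |τ| ≤ 2 ^ (k + 2) := by
  have h1 : φ (τ / 2 ^ ((k + 1 : ℕ) : ℤ)) ≠ 0 := fun h0 => h (by
    rw [zpow_natCast] at h0
    simp [lpPiece, h0])
  obtain ⟨h2, h3⟩ := hφ.dyadic_bounds h1
  rw [show ((k + 1 : ℕ) : ℤ) - 1 = (k : ℕ) by push_cast; ring, zpow_natCast] at h2
  rw [show ((k + 1 : ℕ) : ℤ) + 1 = (k + 2 : ℕ) by push_cast; ring, zpow_natCast] at h3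
  exact ⟨h2, h3⟩

lemma lpPiece_eq_zero (hφ : IsLPBump φ) {k : ℕ} {τ : ℝ} (h : 2 ^ (k + 1) < |τ|) :
    lpPiece φ k τ = 0 := by
  cases k with
  | zero =>
    have h2 : 2 < |τ| := by simpa using h
    have h0 : τ ≠ 0 := by
      rintro rfl
      norm_num at h2
    rw [lpPiece, tsum_div_const, hφ.tsum_dyadic_nat_eq h2, div_self (hφ.lpSum_pos h0).ne', sub_self]
  | succ k =>
    by_contra h0
    exact absurd (hφ.lpPiece_succ_ne_zero h0).2 (not_le.2 h)

lemma measurable_tsum_of_nonneg {ι : Type*} [Countable ι] {f : ι → ℝ → ℝ}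
    (hf : ∀ i, Measurable (f i)) (h0 : ∀ i τ, 0 ≤ f i τ) : Measurable fun τ => ∑' i, f i τ := by
  have : (fun τ => ∑' i, f i τ) = fun τ => (∑' i, ENNReal.ofReal (f i τ)).toReal := by
    ext τ
    rw [ENNReal.tsum_toReal_eq fun _ => ENNReal.ofReal_ne_top]
    simp_rw [ENNReal.toReal_ofReal (h0 _ _)]
  rw [this]
  fun_prop

lemma measurable_lpPiece (hφ : IsLPBump φ) (k : ℕ) : Measurable (lpPiece φ k) := by
  have hm := hφ.smooth.continuous.measurable
  have hs : Measurable (lpSum φ) :=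
    measurable_tsum_of_nonneg (fun j => by fun_prop) fun _ _ => hφ.nonneg _
  have hsucc : ∀ k, Measurable (lpPiece φ (k + 1)) := by
    intro k
    change Measurable fun τ => φ (τ / 2 ^ (k + 1)) / lpSum φ τ
    fun_prop
  cases k with
  | zero =>
    exact measurable_const.sub
      (measurable_tsum_of_nonneg hsucc fun k τ => hφ.lpPiece_nonneg (k + 1) τ)
  | succ k => exact hsucc k

end IsLPBump

lemma lintegral_enorm_fourier_rpow_four_le {V : Type*} [NormedAddCommGroup V]
    [InnerProductSpace ℝ V] [FiniteDimensional ℝ V] [MeasurableSpace V] [BorelSpace V]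
    (h : SchwartzMap V ℂ) :
    ∫⁻ v, ‖FourierTransform.fourier h v‖ₑ ^ 4 ≤
      ∫⁻ x, (∫⁻ y, ‖h y‖ₑ * ‖h (x - y)‖ₑ) ^ 2 := by
  set w : SchwartzMap V ℂ := SchwartzMap.convolution (.mul ℂ ℂ) h h with hw
  have hl2 : ∀ g : SchwartzMap V ℂ, ∫⁻ v, ‖g v‖ₑ ^ 2 = ENNReal.ofReal (∫ v, ‖g v‖ ^ 2) := by
    intro g
    have hi : Integrable fun v => ‖g v‖ ^ 2 := (g.memLp 2).integrable_norm_pow two_ne_zero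
    rw [ofReal_integral_eq_lintegral_ofReal hi (ae_of_all _ fun _ => by positivity)]
    refine lintegral_congr fun v => ?_
    rw [ENNReal.ofReal_pow (norm_nonneg _), ofReal_norm]
  calc ∫⁻ v, ‖FourierTransform.fourier h v‖ₑ ^ 4
      = ∫⁻ v, ‖FourierTransform.fourier w v‖ₑ ^ 2 := by
        refine lintegral_congr fun v => ?_
        rw [hw, SchwartzMap.fourier_convolution, SchwartzMap.pairing_apply_apply,
          ContinuousLinearMap.mul_apply', enorm_mul]
        ring
    _ = ∫⁻ v, ‖w v‖ₑ ^ 2 := by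
        rw [hl2, hl2, SchwartzMap.integral_norm_sq_fourier]
    _ ≤ _ := by
        gcongr with x
        rw [hw, SchwartzMap.convolution_apply, convolution]
        refine (enorm_integral_le_lintegral_enorm _).trans_eq (lintegral_congr fun y => ?_)
        rw [ContinuousLinearMap.mul_apply', enorm_mul]

lemma exists_volume_eq_smul_map {E F : Type*} [NormedAddCommGroup E] [NormedSpace ℝ E]
    [MeasurableSpace E] [BorelSpace E] [NormedAddCommGroup F] [NormedSpace ℝ F]
    [FiniteDimensional ℝ F] [MeasurableSpace F] [BorelSpace F] (μ : Measure E)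
    [μ.IsAddHaarMeasure] (ν : Measure F) [ν.IsAddHaarMeasure] (e : E ≃L[ℝ] F) :
    ∃ K : NNReal, ν = K • μ.map e := by
  have := e.isAddHaarMeasure_map μ
  exact ⟨_, Measure.isAddLeftInvariant_eq_smul ν (μ.map e)⟩

lemma exists_ftST_convolution_le : ∃ K : NNReal, ∀ f : SchwartzMap SpaceTime ℂ,
    ∃ H : SchwartzMap SpaceTime ℂ, (∀ p : SpaceTime, ftST (fun p => f p) p.1 p.2 = H p) ∧
      ∫⁻ p, ‖f p‖ₑ ^ 4 ≤ K * ∫⁻ x, (∫⁻ y, ‖H y‖ₑ * ‖H (x - y)‖ₑ) ^ 2 := by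
  let e : WithLp 2 (ℝ × E2) ≃L[ℝ] SpaceTime := WithLp.prodContinuousLinearEquiv 2 ℝ ℝ E2
  have hc : -(2 * Real.pi)⁻¹ ≠ 0 := by
    have := Real.pi_pos
    simp only [ne_eq, neg_eq_zero, inv_eq_zero]
    positivity
  let Φ : SpaceTime ≃L[ℝ] WithLp 2 (ℝ × E2) :=
    (ContinuousLinearEquiv.smulLeft (Units.mk0 _ hc)).trans e.symm
  have hΦ : ∀ p, Φ p = WithLp.toLp 2 ((-(2 * Real.pi)⁻¹) • p) := fun p => rfl
  have hvol : (volume : Measure SpaceTime).IsAddHaarMeasure :=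
    Measure.prod.instIsAddHaarMeasure volume volume
  obtain ⟨K, hK⟩ := exists_volume_eq_smul_map (volume : Measure SpaceTime)
    (volume : Measure (WithLp 2 (ℝ × E2))) Φ
  have hmp := WithLp.volume_preserving_ofLp ℝ E2
  refine ⟨K * K ^ 2, fun f => ?_⟩
  let g : SchwartzMap (WithLp 2 (ℝ × E2)) ℂ := SchwartzMap.compCLMOfContinuousLinearEquiv ℂ e f
  have hg : ∀ v, g v = f v.ofLp := fun v => rfl
  let h := FourierTransformInv.fourierInv g
  let H : SchwartzMap SpaceTime ℂ := SchwartzMap.compCLMOfContinuousLinearEquiv ℂ Φ h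
  have hH : ∀ p, H p = h (Φ p) := fun p => rfl
  refine ⟨H, fun p => ?_, ?_⟩
  · rw [hH, SchwartzMap.fourierInv_coe, Real.fourierInv_eq', ftST,
      ← hmp.integral_comp (MeasurableEquiv.toLp 2 (ℝ × E2)).symm.measurableEmbedding]
    refine integral_congr_ae (ae_of_all _ fun v => ?_)
    simp only [hg, smul_eq_mul, hΦ, WithLp.prod_inner_apply]
    congr 2
    simp only [Prod.smul_fst, Prod.smul_snd, inner_smul_right, smul_eq_mul]
    have hpi : (Real.pi : ℂ) ≠ 0 := by exact_mod_cast Real.pi_ne_zero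
    rw [show ∀ a b : ℝ, ⟪a, b⟫ = b * a from fun a b => by simp [RCLike.inner_apply]]
    push_cast
    field_simp
    ring
  · have hmap : ∀ u : WithLp 2 (ℝ × E2) → ENNReal, Measurable u →
        ∫⁻ v, u v = K * ∫⁻ p, u (Φ p) := by
      intro u hu
      rw [hK, lintegral_smul_measure, lintegral_map hu Φ.continuous.measurable]
      rfl
    have hmain := lintegral_enorm_fourier_rpow_four_le h
    have hF : FourierTransform.fourier h = g := FourierTransform.fourier_fourierInv_eq g
    rw [hF] at hmain
    rw [← hmp.lintegral_comp (by exact f.continuous.enorm.measurable.pow_const 4)]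
    refine hmain.trans (le_of_eq ?_)
    have hm1 : Measurable fun x => ∫⁻ y, ‖h y‖ₑ * ‖h (x - y)‖ₑ := by
      have := h.continuous.measurable
      apply Measurable.lintegral_prod_right
      fun_prop
    rw [hmap _ (hm1.pow_const 2)]
    have hin : ∀ p : SpaceTime, ∫⁻ y, ‖h y‖ₑ * ‖h (Φ p - y)‖ₑ =
        K * ∫⁻ q : SpaceTime, ‖H q‖ₑ * ‖H (p - q)‖ₑ := by
      intro p
      have hm2 : Measurable fun y => ‖h y‖ₑ * ‖h (Φ p - y)‖ₑ := by
        have := h.continuous.measurable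
        fun_prop
      rw [hmap _ hm2]
      simp only [hH, map_sub]
    simp only [hin, mul_pow]
    rw [lintegral_const_mul' _ _ (by simp)]
    push_cast
    ring

lemma integrable_weight_sq_mul (H : SchwartzMap SpaceTime ℂ) :
    Integrable fun p => (4 * (1 + ‖p‖) ^ 2 * ‖H p‖) ^ 2 := by
  have hvol : (volume : Measure SpaceTime).IsAddHaarMeasure :=
    Measure.prod.instIsAddHaarMeasure volume volume
  have hint := ((H.integrable_pow_mul volume 0).add (H.integrable_pow_mul volume 4)).const_mul
    (128 * SchwartzMap.seminorm ℝ 0 0 H)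
  refine hint.mono' (by fun_prop) (ae_of_all _ fun p => ?_)
  have hM := H.norm_le_seminorm ℝ p
  have hx := norm_nonneg p
  have hy := norm_nonneg (H p)
  have h4 : (1 + ‖p‖) ^ 4 ≤ 8 * (1 + ‖p‖ ^ 4) := by
    nlinarith [sq_nonneg (‖p‖ - 1), sq_nonneg (‖p‖ ^ 2 - 1), sq_nonneg (‖p‖ ^ 2 - ‖p‖)]
  rw [Real.norm_of_nonneg (by positivity)]
  simp only [Pi.add_apply, pow_zero, one_mul]
  calc (4 * (1 + ‖p‖) ^ 2 * ‖H p‖) ^ 2 = 16 * (1 + ‖p‖) ^ 4 * (‖H p‖ * ‖H p‖) := by ring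
    _ ≤ 16 * (8 * (1 + ‖p‖ ^ 4)) * (SchwartzMap.seminorm ℝ 0 0 H * ‖H p‖) := by gcongr
    _ = _ := by ring

lemma jap_rpow_le {a x : ℝ} (ha : a ≤ 1) (hx : 0 ≤ x) : jap x ^ a ≤ 1 + x := by
  refine (Real.rpow_le_rpow_of_exponent_le (one_le_jap x) ha).trans ?_
  rw [Real.rpow_one, jap, Real.sqrt_le_left (by positivity)]
  nlinarith

namespace IsLPBump

variable {φ : ℝ → ℝ}

lemma lpPiece_le (hφ : IsLPBump φ) (k : ℕ) (τ : ℝ) : lpPiece φ k τ ≤ 2 * (1 + |τ|) / 2 ^ k := by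
  have hτ := abs_nonneg τ
  cases k with
  | zero =>
    have := hφ.lpPiece_le_one 0 τ
    rw [pow_zero, div_one]
    linarith
  | succ k =>
    rcases eq_or_ne (lpPiece φ (k + 1) τ) 0 with h | h
    · rw [h]
      positivity
    · refine (hφ.lpPiece_le_one _ _).trans ?_
      have := (hφ.lpPiece_succ_ne_zero h).1
      rw [le_div_iff₀ (by positivity), pow_succ]
      linarith

lemma norm_weight_mul_lpPiece_le (hφ : IsLPBump φ) {a s : ℝ} (ha : a ≤ 1) (hs : |s| ≤ 1) (k : ℕ)
    (p : SpaceTime) (z : ℂ) :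
    ‖((jap ‖p.2‖ ^ a * lpPiece φ k (p.1 + s * ‖p.2‖) : ℝ) : ℂ) * z‖ ≤
      4 * (1 + ‖p‖) ^ 2 * ‖z‖ / 2 ^ k := by
  have h1 : ‖p.1‖ ≤ ‖p‖ := norm_fst_le p
  have h2 : ‖p.2‖ ≤ ‖p‖ := norm_snd_le p
  have hp := norm_nonneg p
  have hj : jap ‖p.2‖ ^ a ≤ 1 + ‖p‖ := (jap_rpow_le ha (norm_nonneg _)).trans (by linarith)
  have hτ : |p.1 + s * ‖p.2‖| ≤ 2 * ‖p‖ := by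
    refine (abs_add_le _ _).trans ?_
    rw [abs_mul, abs_norm, ← Real.norm_eq_abs p.1]
    nlinarith [norm_nonneg p.2]
  have hl : lpPiece φ k (p.1 + s * ‖p.2‖) ≤ 4 * (1 + ‖p‖) / 2 ^ k := by
    refine (hφ.lpPiece_le k _).trans (div_le_div_of_nonneg_right ?_ (by positivity))
    linarith
  have hl0 := hφ.lpPiece_nonneg k (p.1 + s * ‖p.2‖)
  have hj0 : 0 ≤ jap ‖p.2‖ ^ a := Real.rpow_nonneg (jap_pos _).le _
  rw [norm_mul, Complex.norm_real, Real.norm_of_nonneg (by positivity)]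
  calc _ ≤ ((1 + ‖p‖) * (4 * (1 + ‖p‖) / 2 ^ k)) * ‖z‖ := by gcongr
    _ = _ := by ring

end IsLPBump

lemma ofReal_XnormB_eq {φ : ℝ → ℝ} (hφ : IsLPBump φ) {a b s : ℝ} (ha : a ≤ 1) (hb : b < 1)
    (hs : |s| ≤ 1) (f : SpaceTime → ℂ) (H : SchwartzMap SpaceTime ℂ)
    (hH : ∀ p : SpaceTime, ftST f p.1 p.2 = H p) :
    ENNReal.ofReal (XnormB φ a b s f) = ∑' k : ℕ, ENNReal.ofReal ((2 : ℝ) ^ (b * k)) *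
      (∫⁻ p : SpaceTime, (ENNReal.ofReal (jap ‖p.2‖ ^ a) *
        (ENNReal.ofReal (lpPiece φ k (p.1 + s * ‖p.2‖)) * ‖H p‖ₑ)) ^ 2) ^ (1 / 2 : ℝ) := by
  set u : ℕ → SpaceTime → ℂ := fun k p =>
    ((jap ‖p.2‖ ^ a * lpPiece φ k (p.1 + s * ‖p.2‖) : ℝ) : ℂ) * H p with hu
  have hum : ∀ k, Measurable (u k) := by
    intro k
    have h1 := hφ.measurable_lpPiece k
    have h2 := H.continuous.measurable
    have h3 := continuous_jap.measurable
    fun_prop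
  have hD := integrable_weight_sq_mul H
  have hle : ∀ k p, ‖u k p‖ ^ 2 ≤ (4 * (1 + ‖p‖) ^ 2 * ‖H p‖) ^ 2 * ((2 ^ k)⁻¹) ^ 2 := by
    intro k p
    rw [← mul_pow, ← div_eq_mul_inv]
    gcongr
    exact hφ.norm_weight_mul_lpPiece_le ha hs k p (H p)
  have hui : ∀ k, Integrable fun p => ‖u k p‖ ^ 2 := fun k =>
    (hD.mul_const _).mono' ((hum k).norm.pow_const 2).aestronglyMeasurable
      (ae_of_all _ fun p => by
        rw [Real.norm_of_nonneg (by positivity)]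
        exact hle k p)
  have hl2 : ∀ k, (l2F fun τ ξ => ((jap ‖ξ‖ ^ a * lpPiece φ k (τ + s * ‖ξ‖) : ℝ) : ℂ) *
      ftST f τ ξ) = Real.sqrt (∫ p, ‖u k p‖ ^ 2) := by
    intro k
    rw [l2F, show (∫ p : SpaceTime, ‖u k p‖ ^ 2) = ∫ τ, ∫ ξ, ‖u k (τ, ξ)‖ ^ 2 from
      integral_prod _ (hui k)]
    congr! 7 with τ ξ
    exact congrArg _ (hH (τ, ξ))
  have hsum : Summable fun k : ℕ => (2 : ℝ) ^ (b * k) * Real.sqrt (∫ p, ‖u k p‖ ^ 2) := by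
    have hgeo : Summable fun k : ℕ => ((2 : ℝ) ^ (b - 1)) ^ k *
        Real.sqrt (∫ p, (4 * (1 + ‖p‖) ^ 2 * ‖H p‖) ^ 2) :=
      (summable_geometric_of_lt_one (by positivity)
        (Real.rpow_lt_one_of_one_lt_of_neg one_lt_two (by linarith))).mul_right _
    refine hgeo.of_nonneg_of_le (fun k => by positivity) fun k => ?_
    have h1 : (∫ p, ‖u k p‖ ^ 2) ≤
        (∫ p, (4 * (1 + ‖p‖) ^ 2 * ‖H p‖) ^ 2) * ((2 ^ k)⁻¹) ^ 2 := by
      rw [← integral_mul_const]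
      exact integral_mono (hui k) (hD.mul_const _) (hle k)
    have h2 := Real.sqrt_le_sqrt h1
    rw [Real.sqrt_mul' _ (by positivity), Real.sqrt_sq (by positivity)] at h2
    have h3 : ((2 : ℝ) ^ (b - 1)) ^ k = 2 ^ (b * k) * (2 ^ k)⁻¹ := by
      rw [← Real.rpow_mul_natCast (by norm_num), ← Real.rpow_natCast 2 k,
        ← Real.rpow_neg (by norm_num), ← Real.rpow_add (by norm_num)]
      ring_nf
    rw [h3]
    calc _ ≤ (2 : ℝ) ^ (b * k) * (Real.sqrt (∫ p, (4 * (1 + ‖p‖) ^ 2 * ‖H p‖) ^ 2) *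
          (2 ^ k)⁻¹) := by gcongr
      _ = _ := by ring
  rw [XnormB]
  simp_rw [hl2]
  rw [ENNReal.ofReal_tsum_of_nonneg (fun k => by positivity) hsum]
  refine tsum_congr fun k => ?_
  rw [ENNReal.ofReal_mul (by positivity), Real.sqrt_eq_rpow,
    ← ENNReal.ofReal_rpow_of_nonneg (integral_nonneg fun p => by positivity) (by norm_num),
    ofReal_integral_eq_lintegral_ofReal (hui k) (ae_of_all _ fun _ => by positivity)]
  congr! 4 with p
  rw [ENNReal.ofReal_pow (norm_nonneg _), ofReal_norm, hu, ← mul_assoc, enorm_mul,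
    ← ENNReal.ofReal_mul (Real.rpow_nonneg (jap_pos _).le _), ← ofReal_norm (E := ℂ) (_ : ℂ),
    Complex.norm_real, Real.norm_of_nonneg
      (mul_nonneg (Real.rpow_nonneg (jap_pos _).le _) (hφ.lpPiece_nonneg _ _))]

/-- There is c > 0 such that for every sign s ∈ {+1,−1} and every Schwartz f on ℝ×ℝ²:
    ‖f‖_{L⁴(ℝ×ℝ²)} ≤ c ‖f‖_{X^{5/12,1/3,1}_s}. -/
theorem L4_le_XnormB :
    ∀ φ : ℝ → ℝ, IsLPBump φ →
      ∃ c : ℝ, 0 < c ∧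
        ∀ s : ℝ, (s = 1 ∨ s = -1) →
          ∀ f : SchwartzMap SpaceTime ℂ,
            (∫ p : SpaceTime, ‖f p‖ ^ (4 : ℝ)) ^ ((1 : ℝ) / 4) ≤
              c * XnormB φ (5 / 12) (1 / 3) s (fun p => f p) := by
  intro φ hφ
  obtain ⟨K, hK⟩ := exists_ftST_convolution_le
  obtain ⟨C, hC, hC'⟩ := exists_convolution_tsum_le
  refine ⟨(K * C ^ 2) ^ ((1 : ℝ) / 4) + 1, by positivity, fun s hs f => ?_⟩
  obtain ⟨H, hH, hfH⟩ := hK f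
  have hs1 : |s| ≤ 1 := by rcases hs with rfl | rfl <;> simp
  set X := XnormB φ (5 / 12) (1 / 3) s (fun p => f p) with hXdef
  have hX0 : 0 ≤ X := tsum_nonneg fun k => mul_nonneg (by positivity) (Real.sqrt_nonneg _)
  have hX := ofReal_XnormB_eq hφ (a := 5 / 12) (b := 1 / 3) (by norm_num) (by norm_num) hs1 _ H hH
  set F : ℕ → SpaceTime → ENNReal := fun k p =>
    ENNReal.ofReal (lpPiece φ k (p.1 + s * ‖p.2‖)) * ‖H p‖ₑ with hF
  have hFm : ∀ k, Measurable (F k) := by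
    intro k
    have h1 := hφ.measurable_lpPiece k
    have h2 := H.continuous.measurable
    fun_prop
  have hFs : ∀ k p, p ∉ coneNhd s (2 ^ (k + 1)) → F k p = 0 := by
    intro k p hp
    have : lpPiece φ k (p.1 + s * ‖p.2‖) = 0 := by
      apply hφ.lpPiece_eq_zero
      simpa [coneNhd] using hp
    simp [hF, this]
  have hsumF : ∀ p, ∑' k, F k p = ‖H p‖ₑ := fun p => by
    rw [hF, ENNReal.tsum_mul_right, hφ.tsum_ofReal_lpPiece, one_mul]
  have hconv := hC' s hs F hFm hFs
  simp only [hsumF] at hconv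
  rw [← hX, ← ENNReal.ofReal_pow hX0, ← ENNReal.ofReal_mul hC] at hconv
  have hQ : ∫⁻ x, (∫⁻ y, ‖H y‖ₑ * ‖H (x - y)‖ₑ) ^ 2 ≤ ENNReal.ofReal ((C * X ^ 2) ^ 2) := by
    have h := pow_le_pow_left' hconv 2
    rwa [← ENNReal.rpow_mul_natCast, show (1 / 2 : ℝ) * (2 : ℕ) = 1 by norm_num, ENNReal.rpow_one,
      ← ENNReal.ofReal_pow (by positivity)] at h
  have hA : ∫⁻ p, ‖f p‖ₑ ^ 4 ≤ ENNReal.ofReal (K * (C * X ^ 2) ^ 2) := by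
    rw [ENNReal.ofReal_mul K.coe_nonneg, ENNReal.ofReal_coe_nnreal]
    exact hfH.trans (mul_le_mul_right hQ _)
  have hint : ∫ p : SpaceTime, ‖f p‖ ^ (4 : ℝ) ≤ K * (C * X ^ 2) ^ 2 := by
    rw [integral_eq_lintegral_of_nonneg_ae (ae_of_all _ fun _ => by positivity)
      (f.continuous.norm.rpow_const fun _ => Or.inr (by norm_num)).aestronglyMeasurable]
    refine ENNReal.toReal_le_of_le_ofReal (by positivity) (le_trans (le_of_eq ?_) hA)
    refine lintegral_congr fun p => ?_
    rw [← ENNReal.ofReal_rpow_of_nonneg (norm_nonneg _) (by norm_num), ofReal_norm]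
    exact_mod_cast ENNReal.rpow_natCast _ 4
  calc (∫ p : SpaceTime, ‖f p‖ ^ (4 : ℝ)) ^ ((1 : ℝ) / 4)
      ≤ (K * C ^ 2 * X ^ 4) ^ ((1 : ℝ) / 4) := by
        refine Real.rpow_le_rpow (integral_nonneg fun p => by positivity) ?_ (by norm_num)
        exact hint.trans_eq (by ring)
    _ = (K * C ^ 2) ^ ((1 : ℝ) / 4) * X := by
        rw [Real.mul_rpow (by positivity) (by positivity), ← Real.rpow_natCast_mul hX0]
        norm_num
    _ ≤ _ := by
        gcongr
        linarith
end
end
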